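/- arXiv:1902.10087 — 4 statements merged into one kernel-verified Lean document; each statement's English description precedes it below -/
import Mathlib

section
/- Let ρ_ABC be an invertible density operator on H_A⊗H_B⊗H_C with marginals ρ_AB, ρ_BC, ρ_B. Then I_{ρ_ABC}(A:C|B) = 0 (equality in strong subadditivity) if and only if log ρ_ABC − log ρ_AB = log ρ_BC − log ρ_B, where each logarithm is extended to the full space by tensoring with identities on the remaining factors. -/
open scoped Matrix ComplexOrder

variable {A B C : Type*}

/-- Functional calculus for Hermitian matrices: apply `f : ℝ → ℝ` to the eigenvalues. -/
noncomputable def matFun {n : Type*} [Fintype n] [DecidableEq n]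
    (f : ℝ → ℝ) (ρ : Matrix n n ℂ) : Matrix n n ℂ :=
  if h : ρ.IsHermitian then
    (h.eigenvectorUnitary : Matrix n n ℂ) *
      Matrix.diagonal (fun i => (f (h.eigenvalues i) : ℂ)) *
        (star (h.eigenvectorUnitary : Matrix n n ℂ))
  else 0

/-- Matrix logarithm via functional calculus. -/
noncomputable def matLog {n : Type*} [Fintype n] [DecidableEq n] (ρ : Matrix n n ℂ) :
    Matrix n n ℂ := matFun Real.log ρ

/-- Matrix square root via functional calculus. -/
noncomputable def matSqrt {n : Type*} [Fintype n] [DecidableEq n] (ρ : Matrix n n ℂ) :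
    Matrix n n ℂ := matFun Real.sqrt ρ

/-- Matrix inverse square root via functional calculus. -/
noncomputable def matInvSqrt {n : Type*} [Fintype n] [DecidableEq n] (ρ : Matrix n n ℂ) :
    Matrix n n ℂ := matFun (fun x => (Real.sqrt x)⁻¹) ρ

/-- A density operator: positive semidefinite with trace one. -/
def IsDensity {n : Type*} [Fintype n] (ρ : Matrix n n ℂ) : Prop :=
  ρ.PosSemidef ∧ ρ.trace = 1

/-- The von Neumann entropy `S(ρ) = -Tr(ρ log ρ)`, computed via eigenvalues. -/
noncomputable def vnEntropy {n : Type*} [Fintype n] [DecidableEq n] (ρ : Matrix n n ℂ) : ℝ :=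
  if h : ρ.IsHermitian then -∑ i, h.eigenvalues i * Real.log (h.eigenvalues i) else 0

/-- The quantum relative entropy `S(ρ‖σ) = Tr[ρ (log ρ - log σ)]`. -/
noncomputable def relEntropy {n : Type*} [Fintype n] [DecidableEq n]
    (ρ σ : Matrix n n ℂ) : ℝ := ((ρ * (matLog ρ - matLog σ)).trace).re

section Tripartite

variable [Fintype A] [Fintype B] [Fintype C]

/-- Partial trace over the third factor. -/
noncomputable def ptC (ρ : Matrix (A × B × C) (A × B × C) ℂ) : Matrix (A × B) (A × B) ℂ :=
  fun x y => ∑ c : C, ρ (x.1, x.2, c) (y.1, y.2, c)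

/-- Partial trace over the first factor. -/
noncomputable def ptA (ρ : Matrix (A × B × C) (A × B × C) ℂ) : Matrix (B × C) (B × C) ℂ :=
  fun x y => ∑ a : A, ρ (a, x) (a, y)

/-- Partial trace over the first and third factors. -/
noncomputable def ptAC (ρ : Matrix (A × B × C) (A × B × C) ℂ) : Matrix B B ℂ :=
  fun b b' => ∑ a : A, ∑ c : C, ρ (a, b, c) (a, b', c)

/-- Partial trace over the first and second factors. -/
noncomputable def ptAB (ρ : Matrix (A × B × C) (A × B × C) ℂ) : Matrix C C ℂ :=
  fun c c' => ∑ a : A, ∑ b : B, ρ (a, b, c) (a, b, c')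

/-- Partial trace over the second and third factors. -/
noncomputable def ptBC (ρ : Matrix (A × B × C) (A × B × C) ℂ) : Matrix A A ℂ :=
  fun a a' => ∑ b : B, ∑ c : C, ρ (a, b, c) (a', b, c)

/-- Partial trace of a bipartite state over its first factor. -/
noncomputable def bptFst {X Y : Type*} [Fintype X] [Fintype Y]
    (M : Matrix (X × Y) (X × Y) ℂ) : Matrix Y Y ℂ :=
  fun b b' => ∑ x : X, M (x, b) (x, b')

/-- Partial trace of a bipartite state over its second factor. -/
noncomputable def bptSnd {X Y : Type*} [Fintype X] [Fintype Y]
    (M : Matrix (X × Y) (X × Y) ℂ) : Matrix X X ℂ :=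
  fun a a' => ∑ y : Y, M (a, y) (a', y)

variable [DecidableEq A] [DecidableEq B] [DecidableEq C]

/-- Extend an operator on the first two factors to the tripartite space: `M ⊗ id_C`. -/
noncomputable def extAB (M : Matrix (A × B) (A × B) ℂ) :
    Matrix (A × B × C) (A × B × C) ℂ :=
  fun x y => M (x.1, x.2.1) (y.1, y.2.1) * (if x.2.2 = y.2.2 then 1 else 0)

/-- Extend an operator on the last two factors to the tripartite space: `id_A ⊗ M`. -/
noncomputable def extBC (M : Matrix (B × C) (B × C) ℂ) :
    Matrix (A × B × C) (A × B × C) ℂ :=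
  fun x y => (if x.1 = y.1 then 1 else 0) * M x.2 y.2

/-- Extend an operator on the middle factor to the tripartite space: `id_A ⊗ M ⊗ id_C`. -/
noncomputable def extB (M : Matrix B B ℂ) : Matrix (A × B × C) (A × B × C) ℂ :=
  fun x y => (if x.1 = y.1 then 1 else 0) * M x.2.1 y.2.1 * (if x.2.2 = y.2.2 then 1 else 0)

/-- Quantum conditional mutual information `I_ρ(A:C|B)`. -/
noncomputable def qcmi (ρ : Matrix (A × B × C) (A × B × C) ℂ) : ℝ :=
  vnEntropy (ptC ρ) + vnEntropy (ptA ρ) - vnEntropy (ptAC ρ) - vnEntropy ρ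

end Tripartite


set_option linter.unusedSectionVars false

open Filter Topology in
theorem aux_mono (F g : ℝ → ℝ) (hd : ∀ t, 0 ≤ t → HasDerivAt F (g t) t)
    (hg : ∀ t, 0 ≤ t → 0 ≤ g t) (h0 : F 0 = 0) (hlim : Tendsto F atTop (𝓝 0)) :
    ∀ t, 0 ≤ t → g t = 0 := by
  have hmono : MonotoneOn F (Set.Ici 0) := by
    apply monotoneOn_of_deriv_nonneg (convex_Ici 0)
    · exact fun t ht => (hd t ht).continuousAt.continuousWithinAt
    · intro t ht
      rw [interior_Ici] at ht
      exact (hd t (le_of_lt ht)).differentiableAt.differentiableWithinAt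
    · intro t ht
      rw [interior_Ici] at ht
      rw [(hd t (le_of_lt ht)).deriv]
      exact hg t (le_of_lt ht)
  have hz : ∀ t, 0 ≤ t → F t = 0 := by
    intro t ht
    apply le_antisymm
    · apply ge_of_tendsto hlim
      filter_upwards [eventually_ge_atTop t] with u hu
      exact hmono ht (ht.trans hu) hu
    · rw [← h0]
      exact hmono (Set.mem_Ici.2 le_rfl) ht ht
  intro t ht
  have h1 := (hd t ht).hasDerivWithinAt (s := Set.Ici t)
  have h2 : HasDerivWithinAt F 0 (Set.Ici t) t := by
    apply (hasDerivWithinAt_const t (Set.Ici t) (0 : ℝ)).congr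
    · intro u hu
      exact hz u (ht.trans hu)
    · exact hz t ht
  exact (uniqueDiffOn_Ici t t (Set.mem_Ici.2 le_rfl)).eq_deriv _ h1 h2

open Filter Topology in
theorem aux_const (F g : ℝ → ℂ) (hd : ∀ t, 0 ≤ t → HasDerivAt F (g t) t)
    (hg : ∀ t, 0 ≤ t → g t = 0) (hlim : Tendsto F atTop (𝓝 0)) : F 0 = 0 := by
  have hc : ∀ T, 0 ≤ T → F T = F 0 := by
    intro T hT
    apply constant_of_has_deriv_right_zero (a := 0) (b := T) _ _ T ⟨hT, le_rfl⟩
    · exact fun t ht => (hd t ht.1).continuousAt.continuousWithinAt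
    · intro t ht
      have := (hd t ht.1).hasDerivWithinAt (s := Set.Ici t)
      rwa [hg t ht.1] at this
  have : Tendsto F atTop (𝓝 (F 0)) := by
    apply tendsto_const_nhds.congr'
    filter_upwards [eventually_ge_atTop 0] with T hT
    exact (hc T hT).symm
  exact tendsto_nhds_unique this hlim

open Filter Topology in
theorem aux_log_tendsto (l : ℝ) :
    Tendsto (fun t : ℝ => Real.log (l + t) - Real.log t) atTop (𝓝 0) := by
  have h1 : Tendsto (fun t : ℝ => l / t + 1) atTop (𝓝 1) := by
    simpa using (tendsto_const_nhds (x := l)).div_atTop tendsto_id |>.add_const 1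
  have h2 := (Real.continuousAt_log one_ne_zero).tendsto.comp h1
  rw [Real.log_one] at h2
  apply h2.congr'
  filter_upwards [eventually_gt_atTop 0, eventually_gt_atTop (-l)] with t ht hl
  have : l + t ≠ 0 := by linarith
  rw [← Real.log_div this ht.ne']
  simp only [Function.comp]
  congr 1
  field_simp

theorem aux_sum_deriv {ι : Type*} [Fintype ι] (a : ι → ℂ) (l : ι → ℝ) (hl : ∀ i, 0 < l i)
    (t : ℝ) (ht : 0 ≤ t) :
    HasDerivAt (fun t : ℝ => ∑ i, ((Real.log (l i + t) : ℝ) : ℂ) * a i)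
      (∑ i, (((l i + t)⁻¹ : ℝ) : ℂ) * a i) t := by
  apply HasDerivAt.fun_sum
  intro i _
  apply HasDerivAt.mul_const
  apply HasDerivAt.ofReal_comp
  have h := ((hasDerivAt_id t).const_add (l i)).log (by have := hl i; simp; linarith)
  simpa using h

open Filter Topology in
theorem aux_sum_tendsto {ι κ : Type*} [Fintype ι] [Fintype κ] (a : ι → ℂ) (l : ι → ℝ)
    (b : κ → ℂ) (m : κ → ℝ) (hab : ∑ i, a i = ∑ j, b j) :
    Tendsto (fun t : ℝ => ∑ i, ((Real.log (l i + t) : ℝ) : ℂ) * a i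
      - ∑ j, ((Real.log (m j + t) : ℝ) : ℂ) * b j) atTop (𝓝 0) := by
  have key : ∀ {ι : Type _} [Fintype ι] (a : ι → ℂ) (l : ι → ℝ),
      Tendsto (fun t : ℝ => ∑ i, ((Real.log (l i + t) - Real.log t : ℝ) : ℂ) * a i)
        atTop (𝓝 0) := by
    intro ι _ a l
    rw [← Finset.sum_const_zero (ι := ι) (s := Finset.univ)]
    apply tendsto_finsetSum
    intro i _
    have := ((Complex.continuous_ofReal.tendsto 0).comp (aux_log_tendsto (l i))).mul_const (a i)
    simpa using this
  have key2 : Tendsto (fun t : ℝ => ∑ i, ((Real.log (m i + t) - Real.log t : ℝ) : ℂ) * b i)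
        atTop (𝓝 0) := by
    rw [← Finset.sum_const_zero (ι := κ) (s := Finset.univ)]
    apply tendsto_finsetSum
    intro i _
    have := ((Complex.continuous_ofReal.tendsto 0).comp (aux_log_tendsto (m i))).mul_const (b i)
    simpa using this
  have h := (key a l).sub key2
  rw [sub_zero] at h
  refine h.congr fun t => ?_
  simp only [Complex.ofReal_sub, sub_mul, Finset.sum_sub_distrib, ← Finset.mul_sum, hab]
  ring

/-- Spectral data of a matrix. -/
def IsSpec {n ι : Type*} [Fintype n] [DecidableEq n] [Fintype ι]
    (σ : Matrix n n ℂ) (s : ι → ℝ) (P : ι → Matrix n n ℂ) : Prop :=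
  ∑ i, P i = 1 ∧ (∀ i, σ * P i = (s i : ℂ) • P i) ∧ (∀ i, P i * σ = (s i : ℂ) • P i) ∧
    ∀ i, 0 < s i

/-- The function `k` of the relative modular operator applied to the identity. -/
noncomputable def modF {n ι κ : Type*} [Fintype n] [Fintype ι] [Fintype κ]
    (s : ι → ℝ) (P : ι → Matrix n n ℂ) (r : κ → ℝ) (Q : κ → Matrix n n ℂ) (k : ℝ → ℝ) :
    Matrix n n ℂ := ∑ p : ι × κ, ((k (s p.1 / r p.2) : ℝ) : ℂ) • (P p.1 * Q p.2)

section Core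

variable {n ι κ : Type*} [Fintype n] [DecidableEq n] [Fintype ι] [Fintype κ]
  {σ ρ : Matrix n n ℂ} {s : ι → ℝ} {P : ι → Matrix n n ℂ} {r : κ → ℝ} {Q : κ → Matrix n n ℂ}

theorem spec_sum (hs : IsSpec σ s P) (hr : IsSpec ρ r Q) :
    ∑ p : ι × κ, P p.1 * Q p.2 = 1 := by
  rw [Fintype.sum_prod_type]
  simp only [← Finset.mul_sum, hs.1, hr.1, mul_one]

theorem modF_log (hs : IsSpec σ s P) (hr : IsSpec ρ r Q) :
    modF s P r Q (fun x => Real.log (x + 0)) =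
      ∑ i, ((Real.log (s i) : ℝ) : ℂ) • P i - ∑ j, ((Real.log (r j) : ℝ) : ℂ) • Q j := by
  have h1 : ∑ p : ι × κ, ((Real.log (s p.1) : ℝ) : ℂ) • (P p.1 * Q p.2)
      = ∑ i, ((Real.log (s i) : ℝ) : ℂ) • P i := by
    rw [Fintype.sum_prod_type]
    simp only [← Finset.smul_sum, ← Finset.mul_sum, hr.1, mul_one]
  have h2 : ∑ p : ι × κ, ((Real.log (r p.2) : ℝ) : ℂ) • (P p.1 * Q p.2)
      = ∑ j, ((Real.log (r j) : ℝ) : ℂ) • Q j := by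
    rw [Fintype.sum_prod_type_right]
    simp only [← Finset.smul_sum, ← Finset.sum_mul, hs.1, one_mul]
  rw [← h1, ← h2, ← Finset.sum_sub_distrib, modF]
  refine Finset.sum_congr rfl fun p _ => ?_
  rw [add_zero, Real.log_div (hs.2.2.2 _).ne' (hr.2.2.2 _).ne', Complex.ofReal_sub, sub_smul]

theorem modF_sylvester (hs : IsSpec σ s P) (hr : IsSpec ρ r Q) (t : ℝ) (ht : 0 ≤ t) :
    σ * modF s P r Q (fun x => (x + t)⁻¹) + (t : ℂ) • (modF s P r Q (fun x => (x + t)⁻¹) * ρ)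
      = ρ := by
  have h2 : ∑ p : ι × κ, ((r p.2 : ℝ) : ℂ) • (P p.1 * Q p.2) = ρ := by
    calc _ = ∑ p : ι × κ, (P p.1 * Q p.2) * ρ := by
          refine Finset.sum_congr rfl fun p _ => ?_
          rw [mul_assoc, hr.2.2.1, mul_smul_comm]
      _ = ρ := by rw [← Finset.sum_mul, spec_sum hs hr, one_mul]
  conv_rhs => rw [← h2]
  rw [modF, Finset.mul_sum, Finset.sum_mul, Finset.smul_sum, ← Finset.sum_add_distrib]
  refine Finset.sum_congr rfl fun p _ => ?_
  rw [mul_smul_comm, ← mul_assoc, hs.2.1, smul_mul_assoc, smul_mul_assoc, mul_assoc, hr.2.2.1,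
    mul_smul_comm, smul_smul, smul_smul, smul_smul, ← add_smul]
  congr 1
  have h1 := hs.2.2.2 p.1
  have h3 := hr.2.2.2 p.2
  have h4 : s p.1 / r p.2 + t ≠ 0 := by positivity
  have h5 : s p.1 + t * r p.2 ≠ 0 := by positivity
  norm_cast
  field_simp

theorem modF_deriv (hs : IsSpec σ s P) (hr : IsSpec ρ r Q) (φ : Matrix n n ℂ →ₗ[ℂ] ℂ)
    (t : ℝ) (ht : 0 ≤ t) :
    HasDerivAt (fun t : ℝ => φ (modF s P r Q (fun x => Real.log (x + t))))
      (φ (modF s P r Q (fun x => (x + t)⁻¹))) t := by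
  simp only [modF, map_sum, map_smul, smul_eq_mul]
  exact aux_sum_deriv (fun p : ι × κ => φ (P p.1 * Q p.2)) (fun p => s p.1 / r p.2)
    (fun p => div_pos (hs.2.2.2 _) (hr.2.2.2 _)) t ht

theorem trace_form_zero {σ Z : Matrix n n ℂ} (hσ : σ.PosDef)
    (h : ((Zᴴ * σ * Z).trace).re ≤ 0) : Z = 0 := by
  have hp := hσ.posSemidef.conjTranspose_mul_mul_same Z
  have h0 : (Zᴴ * σ * Z).trace = 0 := by
    have h1 := hp.trace_nonneg
    rw [Complex.le_def] at h1
    apply Complex.ext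
    · exact le_antisymm h h1.1
    · exact h1.2.symm
  have h2 := hp.trace_eq_zero_iff.1 h0
  by_contra hZ
  have : ∃ j, Z.col j ≠ 0 := by
    by_contra hc
    push Not at hc
    exact hZ (by ext i j; exact congrFun (hc j) i)
  obtain ⟨j, hj⟩ := this
  have h3 := hσ.dotProduct_mulVec_pos hj
  have h4 : (Zᴴ * σ * Z) j j = star (Z.col j) ⬝ᵥ (σ *ᵥ Z.col j) := by
    rw [Matrix.mul_assoc, Matrix.mul_apply']
    rfl
  rw [← h4, h2] at h3
  simp at h3

variable {m ι' κ' : Type*} [Fintype m] [DecidableEq m] [Fintype ι'] [Fintype κ']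
  {σ' ρ' : Matrix m m ℂ} {s' : ι' → ℝ} {P' : ι' → Matrix m m ℂ} {r' : κ' → ℝ}
  {Q' : κ' → Matrix m m ℂ}

theorem quad_identity (E : Matrix m m ℂ →ₗ[ℂ] Matrix n n ℂ)
    (hmul : ∀ X Y, E (X * Y) = E X * E Y) (hstar : ∀ X, E Xᴴ = (E X)ᴴ)
    (htρ : ∀ X, (ρ * E X).trace = (ρ' * X).trace)
    (htσ : ∀ X, (σ * E X).trace = (σ' * X).trace)
    (hσ : σ.IsHermitian) (hρ : ρ.IsHermitian) (hρ' : ρ'.IsHermitian)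
    (t : ℝ) (R : Matrix n n ℂ) (R' : Matrix m m ℂ)
    (hR : σ * R + (t : ℂ) • (R * ρ) = ρ) (hR' : σ' * R' + (t : ℂ) • (R' * ρ') = ρ') :
    (((E R' - R)ᴴ * σ * (E R' - R)).trace).re + t * (((E R' - R) * ρ * (E R' - R)ᴴ).trace).re
      = ((ρ * R).trace).re - ((ρ' * R').trace).re := by
  have form : ∀ X Y : Matrix n n ℂ, (Xᴴ * σ * Y).trace + (t : ℂ) * (Y * ρ * Xᴴ).trace
      = (Xᴴ * (σ * Y + (t : ℂ) • (Y * ρ))).trace := by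
    intro X Y
    rw [mul_add, Matrix.trace_add, mul_smul_comm, Matrix.trace_smul, smul_eq_mul,
      Matrix.trace_mul_comm (Y * ρ), mul_assoc]
  have tr_star : ∀ {k : Type _} [Fintype k] (X M : Matrix k k ℂ), M.IsHermitian →
      ((Xᴴ * M).trace).re = ((M * X).trace).re := by
    intro k _ X M hM
    have : Xᴴ * M = (M * X)ᴴ := by rw [Matrix.conjTranspose_mul, hM.eq]
    rw [this, Matrix.trace_conjTranspose]
    simp
  have tr_star' : ((R'ᴴ * ρ').trace).re = ((ρ' * R').trace).re := by
    have : R'ᴴ * ρ' = (ρ' * R')ᴴ := by rw [Matrix.conjTranspose_mul, hρ'.eq]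
    rw [this, Matrix.trace_conjTranspose]
    simp
  set Y := E R' with hY
  have e1 : ((Yᴴ * (σ * R + (t : ℂ) • (R * ρ))).trace).re = ((ρ' * R').trace).re := by
    rw [hR, tr_star _ _ hρ, htρ]
  have e2 : ((Rᴴ * (σ * R + (t : ℂ) • (R * ρ))).trace).re = ((ρ * R).trace).re := by
    rw [hR, tr_star _ _ hρ]
  have e3 : ((Rᴴ * (σ * Y + (t : ℂ) • (Y * ρ))).trace).re = ((ρ' * R').trace).re := by
    rw [← e1]
    have hh : (Rᴴ * (σ * Y + (t : ℂ) • (Y * ρ))).trace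
        = star ((Yᴴ * (σ * R + (t : ℂ) • (R * ρ))).trace) := by
      rw [← form, ← form, star_add, star_mul', ← Matrix.trace_conjTranspose,
        ← Matrix.trace_conjTranspose]
      simp only [Matrix.conjTranspose_mul, Matrix.conjTranspose_conjTranspose, hσ.eq, hρ.eq,
        mul_assoc]
      simp
    rw [hh]
    simp
  have e4 : ((Yᴴ * (σ * Y + (t : ℂ) • (Y * ρ))).trace).re = ((ρ' * R').trace).re := by
    rw [← form]
    have a1 : (Yᴴ * σ * Y).trace = (R'ᴴ * (σ' * R')).trace := by
      rw [mul_assoc, Matrix.trace_mul_comm, mul_assoc, hY, ← hstar, ← hmul, htσ, ← mul_assoc,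
        Matrix.trace_mul_comm]
    have a2 : (Y * ρ * Yᴴ).trace = (R'ᴴ * (R' * ρ')).trace := by
      rw [mul_assoc, Matrix.trace_mul_comm, mul_assoc, hY, ← hstar, ← hmul, htρ,
        Matrix.trace_mul_comm, mul_assoc]
    rw [a1, a2, ← smul_eq_mul (t : ℂ), ← Matrix.trace_smul, ← mul_smul_comm, ← Matrix.trace_add, ← mul_add,
      hR', tr_star']
  have e5 := form (Y - R) (Y - R)
  have e6 : (Y - R)ᴴ * (σ * (Y - R) + (t : ℂ) • ((Y - R) * ρ)) =
      Yᴴ * (σ * Y + (t : ℂ) • (Y * ρ)) - Yᴴ * (σ * R + (t : ℂ) • (R * ρ))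
      - Rᴴ * (σ * Y + (t : ℂ) • (Y * ρ)) + Rᴴ * (σ * R + (t : ℂ) • (R * ρ)) := by
    rw [Matrix.conjTranspose_sub]
    simp only [mul_sub, sub_mul, mul_add, smul_sub]
    abel
  rw [e6] at e5
  have e7 := congrArg Complex.re e5
  simp only [Matrix.trace_add, Matrix.trace_sub, Complex.add_re, Complex.sub_re,
    Complex.re_ofReal_mul] at e7 e1 e2 e3 e4 ⊢
  linarith

open Filter Topology in
theorem core (E : Matrix m m ℂ →ₗ[ℂ] Matrix n n ℂ)
    (hmul : ∀ X Y, E (X * Y) = E X * E Y) (hstar : ∀ X, E Xᴴ = (E X)ᴴ) (hone : E 1 = 1)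
    (htρ : ∀ X, (ρ * E X).trace = (ρ' * X).trace)
    (htσ : ∀ X, (σ * E X).trace = (σ' * X).trace)
    (hσ : σ.PosDef) (hρ : ρ.PosDef) (hρ' : ρ'.IsHermitian)
    (hs : IsSpec σ s P) (hr : IsSpec ρ r Q) (hs' : IsSpec σ' s' P') (hr' : IsSpec ρ' r' Q')
    (heq : ((ρ * (∑ i, ((Real.log (s i) : ℝ) : ℂ) • P i
        - ∑ j, ((Real.log (r j) : ℝ) : ℂ) • Q j)).trace).re
      = ((ρ' * (∑ i, ((Real.log (s' i) : ℝ) : ℂ) • P' i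
        - ∑ j, ((Real.log (r' j) : ℝ) : ℂ) • Q' j)).trace).re) :
    (∑ i, ((Real.log (s i) : ℝ) : ℂ) • P i - ∑ j, ((Real.log (r j) : ℝ) : ℂ) • Q j)
      = E (∑ i, ((Real.log (s' i) : ℝ) : ℂ) • P' i
        - ∑ j, ((Real.log (r' j) : ℝ) : ℂ) • Q' j) := by
  rw [← modF_log hs hr, ← modF_log hs' hr'] at heq ⊢
  have hlim : ∀ (φ : Matrix n n ℂ →ₗ[ℂ] ℂ) (ψ : Matrix m m ℂ →ₗ[ℂ] ℂ), φ 1 = ψ 1 →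
      Tendsto (fun t : ℝ => φ (modF s P r Q (fun x => Real.log (x + t)))
        - ψ (modF s' P' r' Q' (fun x => Real.log (x + t)))) atTop (𝓝 0) := by
    intro φ ψ h1
    simp only [modF, map_sum, map_smul, smul_eq_mul]
    apply aux_sum_tendsto (fun p : ι × κ => φ (P p.1 * Q p.2)) (fun p => s p.1 / r p.2)
      (fun p : ι' × κ' => ψ (P' p.1 * Q' p.2)) (fun p => s' p.1 / r' p.2)
    rw [← map_sum, ← map_sum, spec_sum hs hr, spec_sum hs' hr', h1]
  have hsyl : ∀ t : ℝ, 0 ≤ t → _ := fun t ht =>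
    quad_identity E hmul hstar htρ htσ hσ.1 hρ.1 hρ' t _ _ (modF_sylvester hs hr t ht)
      (modF_sylvester hs' hr' t ht)
  have hnn2 : ∀ Z : Matrix n n ℂ, 0 ≤ ((Z * ρ * Zᴴ).trace).re := fun Z =>
    (Complex.le_def.1 (hρ.posSemidef.mul_mul_conjTranspose_same Z).trace_nonneg).1
  have hnn1 : ∀ Z : Matrix n n ℂ, 0 ≤ ((Zᴴ * σ * Z).trace).re := fun Z =>
    (Complex.le_def.1 (hσ.posSemidef.conjTranspose_mul_mul_same Z).trace_nonneg).1
  let φ : Matrix n n ℂ →ₗ[ℂ] ℂ := Matrix.traceLinearMap n ℂ ℂ ∘ₗ LinearMap.mulLeft ℂ ρ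
  let ψ : Matrix m m ℂ →ₗ[ℂ] ℂ := Matrix.traceLinearMap m ℂ ℂ ∘ₗ LinearMap.mulLeft ℂ ρ'
  have hφ : ∀ X, φ X = (ρ * X).trace := fun X => rfl
  have hψ : ∀ X, ψ X = (ρ' * X).trace := fun X => rfl
  have hφψ : φ 1 = ψ 1 := by rw [hφ, hψ, ← htρ, hone]
  have hg0 := aux_mono
    (fun t => (φ (modF s P r Q (fun x => Real.log (x + t)))
        - ψ (modF s' P' r' Q' (fun x => Real.log (x + t)))).re)
    (fun t => (φ (modF s P r Q (fun x => (x + t)⁻¹))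
        - ψ (modF s' P' r' Q' (fun x => (x + t)⁻¹))).re)
    (by
      intro t ht
      have h := (modF_deriv hs hr φ t ht).sub (modF_deriv hs' hr' ψ t ht)
      exact Complex.reCLM.hasFDerivAt.comp_hasDerivAt t h)
    (by
      intro t ht
      simp only [Complex.sub_re, hφ, hψ]
      rw [← hsyl t ht]
      exact add_nonneg (hnn1 _) (mul_nonneg ht (hnn2 _)))
    (by simp only [Complex.sub_re, hφ, hψ, heq, sub_self])
    (by
      exact (Complex.continuous_re.tendsto' 0 0 Complex.zero_re).comp (hlim φ ψ hφψ))
  have hR : ∀ t : ℝ, 0 ≤ t → modF s P r Q (fun x => (x + t)⁻¹)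
      = E (modF s' P' r' Q' (fun x => (x + t)⁻¹)) := by
    intro t ht
    have h1 := hg0 t ht
    simp only [Complex.sub_re, hφ, hψ] at h1
    rw [← hsyl t ht] at h1
    have h2 := mul_nonneg ht (hnn2 (E (modF s' P' r' Q' (fun x => (x + t)⁻¹))
      - modF s P r Q (fun x => (x + t)⁻¹)))
    exact (sub_eq_zero.1 (trace_form_zero hσ (by linarith))).symm
  ext x y
  let e : Matrix n n ℂ →ₗ[ℂ] ℂ := Matrix.entryLinearMap ℂ ℂ x y
  have he : ∀ X, e X = X x y := fun X => rfl
  rw [← sub_eq_zero]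
  exact aux_const
    (fun t => e (modF s P r Q (fun x => Real.log (x + t)))
        - (e ∘ₗ E) (modF s' P' r' Q' (fun x => Real.log (x + t))))
    (fun t => e (modF s P r Q (fun x => (x + t)⁻¹))
        - (e ∘ₗ E) (modF s' P' r' Q' (fun x => (x + t)⁻¹)))
    (fun t ht => (modF_deriv hs hr e t ht).sub (modF_deriv hs' hr' _ t ht))
    (fun t ht => by simp [hR t ht])
    (hlim e (e ∘ₗ E) (by simp [hone]))

end Core

theorem exists_spec {n : Type*} [Fintype n] [DecidableEq n] (σ : Matrix n n ℂ) (hσ : σ.PosDef) :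
    ∃ (s : n → ℝ) (P : n → Matrix n n ℂ), IsSpec σ s P ∧
      matLog σ = ∑ i, ((Real.log (s i) : ℝ) : ℂ) • P i := by
  have h := hσ.1
  set U : Matrix n n ℂ := (h.eigenvectorUnitary : Matrix n n ℂ) with hU
  have hU1 : star U * U = 1 := Unitary.coe_star_mul_self h.eigenvectorUnitary
  have hU2 : U * star U = 1 := Unitary.coe_mul_star_self h.eigenvectorUnitary
  have hsp : σ = U * Matrix.diagonal (fun i => (h.eigenvalues i : ℂ)) * star U := by
    conv_lhs => rw [h.spectral_theorem, Unitary.conjStarAlgAut_apply]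
    rfl
  have hdiag : ∀ d : n → ℂ, U * Matrix.diagonal d * star U
      = ∑ i, d i • (U * Matrix.single i i 1 * star U) := by
    intro d
    rw [← Matrix.sum_single_eq_diagonal, Finset.mul_sum, Finset.sum_mul]
    refine Finset.sum_congr rfl fun i _ => ?_
    rw [← smul_mul_assoc, ← mul_smul_comm, Matrix.smul_single, smul_eq_mul, mul_one]
  refine ⟨h.eigenvalues, fun i => U * Matrix.single i i 1 * star U, ⟨?_, ?_, ?_, ?_⟩, ?_⟩
  · have := hdiag (fun _ => 1)
    simp only [one_smul] at this
    rw [← this, Matrix.diagonal_one, mul_one, hU2]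
  · intro i
    conv_lhs => rw [hsp]
    calc _ = U * (Matrix.diagonal (fun i => (h.eigenvalues i : ℂ)) * (star U * U)
          * Matrix.single i i 1) * star U := by simp only [mul_assoc]
      _ = _ := by
        rw [hU1, mul_one, ← smul_mul_assoc, ← mul_smul_comm]
        congr 2
        ext x y
        simp only [Matrix.diagonal_mul, Matrix.smul_apply, smul_eq_mul, Matrix.single_apply]
        split_ifs with hxy
        · obtain ⟨rfl, rfl⟩ := hxy
          simp
        · simp
  · intro i
    conv_lhs => rw [hsp]
    calc _ = U * (Matrix.single i i 1 * (star U * U)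
          * Matrix.diagonal (fun i => (h.eigenvalues i : ℂ))) * star U := by simp only [mul_assoc]
      _ = _ := by
        rw [hU1, mul_one, ← smul_mul_assoc, ← mul_smul_comm]
        congr 2
        ext x y
        simp only [Matrix.mul_diagonal, Matrix.smul_apply, smul_eq_mul, Matrix.single_apply]
        split_ifs with hxy
        · obtain ⟨rfl, rfl⟩ := hxy
          simp
        · simp
  · exact fun i => hσ.eigenvalues_pos i
  · rw [matLog, matFun, dif_pos h, ← hdiag]

theorem vnEntropy_eq {n : Type*} [Fintype n] [DecidableEq n] (σ : Matrix n n ℂ)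
    (h : σ.IsHermitian) : vnEntropy σ = -((σ * matLog σ).trace).re := by
  rw [vnEntropy, dif_pos h, matLog, matFun, dif_pos h]
  set U : Matrix n n ℂ := (h.eigenvectorUnitary : Matrix n n ℂ) with hU
  have hU1 : star U * U = 1 := Unitary.coe_star_mul_self h.eigenvectorUnitary
  have hsp : σ = U * Matrix.diagonal (fun i => (h.eigenvalues i : ℂ)) * star U := by
    conv_lhs => rw [h.spectral_theorem, Unitary.conjStarAlgAut_apply]
    rfl
  have : σ * (U * Matrix.diagonal (fun i => (Real.log (h.eigenvalues i) : ℂ)) * star U)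
      = U * (Matrix.diagonal (fun i => (h.eigenvalues i : ℂ)) *
        Matrix.diagonal (fun i => (Real.log (h.eigenvalues i) : ℂ))) * star U := by
    calc _ = (U * Matrix.diagonal (fun i => (h.eigenvalues i : ℂ)) * star U) *
          (U * Matrix.diagonal (fun i => (Real.log (h.eigenvalues i) : ℂ)) * star U) :=
          congrArg (· * _) hsp
      _ = U * (Matrix.diagonal (fun i => (h.eigenvalues i : ℂ)) * (star U * U) *
        Matrix.diagonal (fun i => (Real.log (h.eigenvalues i) : ℂ))) * star U := by
          simp only [mul_assoc]
      _ = _ := by rw [hU1, mul_one]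
  rw [this, Matrix.trace_mul_comm, ← mul_assoc, hU1, one_mul, Matrix.diagonal_mul_diagonal,
    Matrix.trace_diagonal]
  simp only [← Complex.ofReal_mul, ← Complex.ofReal_sum, Complex.ofReal_re]

section Ext

variable {A B C : Type*} [Fintype A] [Fintype B] [Fintype C]
    [DecidableEq A] [DecidableEq B] [DecidableEq C]

theorem extAB_mul (X Y : Matrix (A × B) (A × B) ℂ) :
    (extAB (X * Y) : Matrix (A × B × C) (A × B × C) ℂ) = extAB X * extAB Y := by
  ext ⟨a, b, c⟩ ⟨a', b', c'⟩
  simp only [extAB, Matrix.mul_apply, Fintype.sum_prod_type]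
  simp

theorem extBC_mul (X Y : Matrix (B × C) (B × C) ℂ) :
    (extBC (X * Y) : Matrix (A × B × C) (A × B × C) ℂ) = extBC X * extBC Y := by
  ext ⟨a, b, c⟩ ⟨a', b', c'⟩
  simp only [extBC, Matrix.mul_apply, Fintype.sum_prod_type]
  by_cases h : a = a' <;> simp [h]

theorem extAB_one : (extAB (1 : Matrix (A × B) (A × B) ℂ) : Matrix (A × B × C) _ ℂ) = 1 := by
  ext ⟨a, b, c⟩ ⟨a', b', c'⟩
  simp only [extAB, Matrix.one_apply, Prod.mk.injEq]
  split_ifs <;> simp_all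

theorem extBC_one : (extBC (1 : Matrix (B × C) (B × C) ℂ) : Matrix (A × B × C) _ ℂ) = 1 := by
  ext ⟨a, b, c⟩ ⟨a', b', c'⟩
  simp only [extBC, Matrix.one_apply, Prod.mk.injEq]
  split_ifs <;> simp_all

/-- `extAB` as a linear map. -/
noncomputable def extABL : Matrix (A × B) (A × B) ℂ →ₗ[ℂ] Matrix (A × B × C) (A × B × C) ℂ where
  toFun := extAB
  map_add' X Y := by ext x y; exact add_mul _ _ _
  map_smul' k X := by ext x y; simp [extAB]

/-- `extBC` as a linear map. -/
noncomputable def extBCL : Matrix (B × C) (B × C) ℂ →ₗ[ℂ] Matrix (A × B × C) (A × B × C) ℂ where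
  toFun := extBC
  map_add' X Y := by ext x y; simp [extBC, mul_add]
  map_smul' k X := by ext x y; simp [extBC]

/-- Extension of an operator on `B` to `B ⊗ C`, as a linear map. -/
noncomputable def extSL : Matrix B B ℂ →ₗ[ℂ] Matrix (B × C) (B × C) ℂ where
  toFun X := fun x y => X x.1 y.1 * (if x.2 = y.2 then 1 else 0)
  map_add' X Y := by ext x y; exact add_mul _ _ _
  map_smul' k X := by ext x y; exact mul_assoc _ _ _

theorem extSL_apply (X : Matrix B B ℂ) (x y : B × C) :
    extSL X x y = X x.1 y.1 * (if x.2 = y.2 then 1 else 0) := rfl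

theorem extSL_mul (X Y : Matrix B B ℂ) :
    (extSL (X * Y) : Matrix (B × C) (B × C) ℂ) = extSL X * extSL Y := by
  ext ⟨b, c⟩ ⟨b', c'⟩
  simp only [extSL_apply, Matrix.mul_apply, Fintype.sum_prod_type]
  simp

theorem extSL_one : (extSL (1 : Matrix B B ℂ) : Matrix (B × C) (B × C) ℂ) = 1 := by
  ext ⟨b, c⟩ ⟨b', c'⟩
  simp only [extSL_apply, Matrix.one_apply, Prod.mk.injEq]
  split_ifs <;> simp_all

theorem extBC_extSL (X : Matrix B B ℂ) :
    (extBC (extSL X) : Matrix (A × B × C) (A × B × C) ℂ) = extB X := by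
  ext ⟨a, b, c⟩ ⟨a', b', c'⟩
  simp [extBC, extSL_apply, extB]

theorem IsSpec.map {n m ι : Type*} [Fintype n] [DecidableEq n] [Fintype m] [DecidableEq m]
    [Fintype ι] {σ : Matrix n n ℂ} {s : ι → ℝ} {P : ι → Matrix n n ℂ} (h : IsSpec σ s P)
    (E : Matrix n n ℂ →ₗ[ℂ] Matrix m m ℂ) (hmul : ∀ X Y, E (X * Y) = E X * E Y)
    (hone : E 1 = 1) : IsSpec (E σ) s (fun i => E (P i)) :=
  ⟨by rw [← map_sum, h.1, hone], fun i => by rw [← hmul, h.2.1, map_smul],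
    fun i => by rw [← hmul, h.2.2.1, map_smul], h.2.2.2⟩

theorem trace_extBC (M : Matrix (A × B × C) (A × B × C) ℂ) (X : Matrix (B × C) (B × C) ℂ) :
    (M * extBC X).trace = (ptA M * X).trace := by
  simp only [Matrix.trace, Matrix.diag, Matrix.mul_apply, extBC, ptA]
  rw [Fintype.sum_prod_type, Finset.sum_comm]
  refine Finset.sum_congr rfl fun y _ => ?_
  simp only [Finset.sum_mul]
  rw [Finset.sum_comm]
  rw [Fintype.sum_prod_type]
  conv_rhs => rw [Finset.sum_comm]
  refine Finset.sum_congr rfl fun a _ => ?_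
  rw [Finset.sum_comm]
  simp

theorem trace_extAB (M : Matrix (A × B × C) (A × B × C) ℂ) (X : Matrix (A × B) (A × B) ℂ) :
    (M * extAB X).trace = (ptC M * X).trace := by
  simp only [Matrix.trace, Matrix.diag, Matrix.mul_apply, extAB, ptC, Fintype.sum_prod_type,
    Finset.sum_mul]
  refine Finset.sum_congr rfl fun a _ => Finset.sum_congr rfl fun b _ => ?_
  rw [Finset.sum_comm]
  refine Finset.sum_congr rfl fun a' _ => ?_
  rw [Finset.sum_comm]
  simp

theorem trace_extB (M : Matrix (A × B × C) (A × B × C) ℂ) (X : Matrix B B ℂ) :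
    (M * extB X).trace = (ptAC M * X).trace := by
  rw [← extBC_extSL, trace_extBC]
  simp only [Matrix.trace, Matrix.diag, Matrix.mul_apply, extSL_apply, ptA, ptAC,
    Fintype.sum_prod_type, Finset.sum_mul]
  refine Finset.sum_congr rfl fun b _ => ?_
  rw [Finset.sum_comm]
  refine Finset.sum_congr rfl fun b' _ => ?_
  rw [Finset.sum_comm]
  simp
  rw [Finset.sum_comm]

theorem ptA_extAB (M : Matrix (A × B × C) (A × B × C) ℂ) :
    ptA (extAB (ptC M) : Matrix (A × B × C) (A × B × C) ℂ) = extSL (ptAC M) := by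
  ext ⟨b, c⟩ ⟨b', c'⟩
  simp [ptA, extAB, ptC, extSL_apply, ptAC]

theorem extAB_posDef {X : Matrix (A × B) (A × B) ℂ} (hX : X.PosDef) :
    (extAB X : Matrix (A × B × C) (A × B × C) ℂ).PosDef := by
  have h := (hX.kronecker (Matrix.PosDef.one (n := C) (R := ℂ))).submatrix
    (e := fun x : A × B × C => ((x.1, x.2.1), x.2.2))
    (by rintro ⟨a, b, c⟩ ⟨a', b', c'⟩ h; simp_all)
  have e : (extAB X : Matrix (A × B × C) (A × B × C) ℂ) =
      (Matrix.kroneckerMap (fun x1 x2 => x1 * x2) X (1 : Matrix C C ℂ)).submatrix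
        (fun x : A × B × C => ((x.1, x.2.1), x.2.2)) (fun x => ((x.1, x.2.1), x.2.2)) := by
    ext x y
    simp [extAB, Matrix.one_apply]
  rw [e]
  exact h

theorem ptA_posDef [Nonempty A] {M : Matrix (A × B × C) (A × B × C) ℂ} (hM : M.PosDef) :
    (ptA M).PosDef := by
  have : ptA M = ∑ a : A, M.submatrix (fun x => (a, x)) (fun x => (a, x)) := by
    ext x y
    simp [ptA, Matrix.sum_apply]
  rw [this]
  exact Matrix.posDef_sum Finset.univ_nonempty
    fun a _ => hM.submatrix (by intro x y h; simpa using h)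

theorem ptC_posDef [Nonempty C] {M : Matrix (A × B × C) (A × B × C) ℂ} (hM : M.PosDef) :
    (ptC M).PosDef := by
  have : ptC M = ∑ c : C, M.submatrix (fun x => (x.1, x.2, c)) (fun x => (x.1, x.2, c)) := by
    ext x y
    simp [ptC, Matrix.sum_apply]
  rw [this]
  exact Matrix.posDef_sum Finset.univ_nonempty
    fun a _ => hM.submatrix (by rintro ⟨a, b⟩ ⟨a', b'⟩ h; simpa using h)

theorem ptAC_posDef [Nonempty A] [Nonempty C] {M : Matrix (A × B × C) (A × B × C) ℂ}
    (hM : M.PosDef) : (ptAC M).PosDef := by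
  have : ptAC M = ∑ a : A, ∑ c : C, M.submatrix (fun x => (a, x, c)) (fun x => (a, x, c)) := by
    ext x y
    simp [ptAC, Matrix.sum_apply]
  rw [this]
  exact Matrix.posDef_sum Finset.univ_nonempty
    fun a _ => Matrix.posDef_sum Finset.univ_nonempty
      fun c _ => hM.submatrix (by intro x y h; simpa using h)

end Ext

/-- (Petz) For an invertible tripartite density operator, equality in strong
subadditivity `I(A:C|B) = 0` holds if and only if
`log ρ_ABC − log ρ_AB = log ρ_BC − log ρ_B` (logarithms extended by identities). -/
theorem ssa_equality_iff_log_identity {A B C : Type*} [Fintype A] [Fintype B] [Fintype C]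
    [DecidableEq A] [DecidableEq B] [DecidableEq C]
    (ρ : Matrix (A × B × C) (A × B × C) ℂ) (hρ : IsDensity ρ) (hρinv : IsUnit ρ) :
    qcmi ρ = 0 ↔
      matLog ρ - extAB (matLog (ptC ρ)) = extBC (matLog (ptA ρ)) - extB (matLog (ptAC ρ)) := by
  
  have hpd : ρ.PosDef := hρ.1.posDef_iff_isUnit.2 hρinv
  have hne : Nonempty (A × B × C) := by
    by_contra h
    rw [not_nonempty_iff] at h
    have := hρ.2
    simp [Matrix.trace] at this
  have hA : Nonempty A := hne.map fun x => x.1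
  have hC : Nonempty C := hne.map fun x => x.2.2
  have hq : qcmi ρ = ((ρ * (matLog ρ - extAB (matLog (ptC ρ)))).trace).re
      - ((ρ * (extBC (matLog (ptA ρ)) - extB (matLog (ptAC ρ)))).trace).re := by
    rw [qcmi, vnEntropy_eq _ hpd.1, vnEntropy_eq _ (ptA_posDef hpd).1,
      vnEntropy_eq _ (ptC_posDef hpd).1, vnEntropy_eq _ (ptAC_posDef hpd).1]
    rw [mul_sub, mul_sub, Matrix.trace_sub, Matrix.trace_sub, trace_extAB, trace_extBC, trace_extB,
      Complex.sub_re, Complex.sub_re]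
    ring
  constructor
  · intro h0
    obtain ⟨r, Q, hr, hlr⟩ := exists_spec ρ hpd
    obtain ⟨s, P, hs, hls⟩ := exists_spec (ptC ρ) (ptC_posDef hpd)
    obtain ⟨r', Q', hr', hlr'⟩ := exists_spec (ptA ρ) (ptA_posDef hpd)
    obtain ⟨s', P', hs', hls'⟩ := exists_spec (ptAC ρ) (ptAC_posDef hpd)
    have hsm := hs.map (extABL (C := C)) extAB_mul extAB_one
    have hsm' := hs'.map (extSL (C := C)) extSL_mul extSL_one
    have e1 : ∑ i, ((Real.log (s i) : ℝ) : ℂ) • extABL (C := C) (P i)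
        = extAB (matLog (ptC ρ)) := by
      rw [hls]
      simp only [← map_smul, ← map_sum]
      rfl
    have e2 : ∑ i, ((Real.log (s' i) : ℝ) : ℂ) • extSL (C := C) (P' i)
        = extSL (matLog (ptAC ρ)) := by
      rw [hls']
      simp only [← map_smul, ← map_sum]
    have e3 : ∀ X Y : Matrix (B × C) (B × C) ℂ,
        (extBC (X - Y) : Matrix (A × B × C) (A × B × C) ℂ) = extBC X - extBC Y :=
      fun X Y => map_sub extBCL X Y
    have key := core (extBCL (A := A) (B := B) (C := C)) extBC_mul
      (by
        intro X
        ext x y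
        simp only [extBCL, LinearMap.coe_mk, AddHom.coe_mk, extBC, Matrix.conjTranspose_apply,
          star_mul']
        congr 1
        by_cases h : x.1 = y.1 <;> simp [h, eq_comm]) extBC_one
      (fun X => trace_extBC ρ X)
      (fun X => by
        rw [← ptA_extAB]
        exact trace_extBC _ X)
      (extAB_posDef (ptC_posDef hpd)) hpd (ptA_posDef hpd).1 hsm hr hsm' hr'
    rw [e1, e2, ← hlr, ← hlr', ← trace_extBC, e3, extBC_extSL] at key
    have hk := key (by
      rw [hq] at h0
      rw [← neg_sub (matLog ρ), ← neg_sub (extBC (matLog (ptA ρ))), mul_neg, mul_neg,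
        Matrix.trace_neg, Matrix.trace_neg, Complex.neg_re, Complex.neg_re]
      linarith)
    have hk' : extAB (matLog (ptC ρ)) - matLog ρ
        = extB (matLog (ptAC ρ)) - extBC (matLog (ptA ρ)) := by
      rw [hk, ← extBC_extSL, ← e3]
      rfl
    rw [← neg_sub, hk', neg_sub]
  · intro h
    rw [hq, h, sub_self]
end

section
/- Let ρ_ABC be an invertible density operator on H_A⊗H_B⊗H_C with marginals ρ_AB, ρ_BC, ρ_B. Then the following two operators on H_C are positive semidefinite: (i) Tr_{AB}[ρ_ABC(log ρ_ABC − log ρ_AB + log ρ_B − log ρ_BC)] and (ii) Tr_{AB}[ρ_AB(log ρ_AB − log ρ_ABC − log ρ_B + log ρ_BC)] (all logarithms extended to the full space by tensoring with identities, and ρ_AB extended as ρ_AB⊗id_C). Moreover each is the zero operator if and only if I_{ρ_ABC}(A:C|B) = 0. -/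
open scoped Matrix ComplexOrder

variable {A B C : Type*}

theorem kr_mono_lim (G g : ℝ → ℝ) (F : ℝ) (hG : ∀ t, 0 ≤ t → HasDerivAt G (g t) t)
    (hg : ∀ t, 0 < t → 0 ≤ g t) (h0 : G 0 = 0) (hF : Filter.Tendsto G Filter.atTop (nhds F)) :
    0 ≤ F ∧ (F = 0 ↔ ∀ t, 0 < t → g t = 0) := by
  have hc : ContinuousOn G (Set.Ici 0) := fun t ht => (hG t ht).continuousAt.continuousWithinAt
  have hd : DifferentiableOn ℝ G (interior (Set.Ici 0)) := fun t ht =>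
    (hG t (interior_subset ht)).differentiableAt.differentiableWithinAt
  have hmono : MonotoneOn G (Set.Ici 0) := by
    apply monotoneOn_of_deriv_nonneg (convex_Ici 0) hc hd
    intro t ht
    rw [interior_Ici] at ht
    rw [(hG t (le_of_lt ht)).deriv]
    exact hg t ht
  have hle : ∀ t, 0 ≤ t → G t ≤ F := by
    intro t ht
    apply ge_of_tendsto hF
    filter_upwards [Filter.eventually_ge_atTop t] with s hs
    exact hmono ht (ht.trans hs) hs
  have hpos : ∀ t, 0 ≤ t → 0 ≤ G t := by
    intro t ht
    rw [← h0]
    exact hmono (Set.mem_Ici.2 le_rfl) ht ht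
  refine ⟨(hpos 0 le_rfl).trans (hle 0 le_rfl), ?_, ?_⟩
  · intro hF0 t ht
    have hz : ∀ s, 0 ≤ s → G s = 0 := fun s hs => le_antisymm (hF0 ▸ hle s hs) (hpos s hs)
    have he : G =ᶠ[nhds t] fun _ => 0 := by
      filter_upwards [lt_mem_nhds ht] with s hs
      exact hz s hs.le
    have := (hG t ht.le).congr_of_eventuallyEq he.symm
    exact this.unique (hasDerivAt_const t (0 : ℝ))
  · intro hz
    have hanti : AntitoneOn G (Set.Ici 0) := by
      apply antitoneOn_of_deriv_nonpos (convex_Ici 0) hc hd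
      intro t ht
      rw [interior_Ici] at ht
      rw [(hG t (le_of_lt ht)).deriv, hz t ht]
    have hz2 : ∀ s, 0 ≤ s → G s = 0 := fun s hs =>
      le_antisymm (h0 ▸ hanti (Set.mem_Ici.2 le_rfl) hs hs) (hpos s hs)
    refine tendsto_nhds_unique hF ?_
    refine (tendsto_const_nhds (x := (0 : ℝ))).congr' ?_
    filter_upwards [Filter.eventually_ge_atTop 0] with s hs
    exact (hz2 s hs).symm

/-- limit of weighted logs, for weights `v` of total mass zero -/
theorem kr_log_lim {P : Type*} [Fintype P] (v l m : P → ℝ) (hl : ∀ p, 0 < l p) (hm : ∀ p, 0 < m p)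
    (h0 : ∑ p, v p = 0) :
    Filter.Tendsto (fun T => ∑ p, v p * (Real.log (l p + T * m p) - Real.log (l p))) Filter.atTop
      (nhds (∑ p, v p * (Real.log (m p) - Real.log (l p)))) := by
  have h1 : Filter.Tendsto (fun T : ℝ => ∑ p, v p * (Real.log (l p * T⁻¹ + m p) - Real.log (l p)))
      Filter.atTop (nhds (∑ p, v p * (Real.log (m p) - Real.log (l p)))) := by
    apply tendsto_finsetSum
    intro p _
    apply Filter.Tendsto.const_mul
    apply Filter.Tendsto.sub_const
    apply Filter.Tendsto.log _ (hm p).ne'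
    have := (tendsto_inv_atTop_zero (𝕜 := ℝ)).const_mul (l p)
    simpa using this.add_const (m p)
  refine h1.congr' ?_
  filter_upwards [Filter.eventually_gt_atTop 0] with T hT
  have : ∀ p, Real.log (l p + T * m p) = Real.log (l p * T⁻¹ + m p) + Real.log T := by
    intro p
    rw [← Real.log_mul _ hT.ne']
    · congr 1
      field_simp
    · have := hl p
      have := hm p
      positivity
  simp_rw [this]
  have : ∑ p, v p * (Real.log (l p * T⁻¹ + m p) + Real.log T - Real.log (l p))
      = ∑ p, v p * (Real.log (l p * T⁻¹ + m p) - Real.log (l p)) + (∑ p, v p) * Real.log T := by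
    rw [Finset.sum_mul, ← Finset.sum_add_distrib]
    exact Finset.sum_congr rfl fun p _ => by ring
  rw [this, h0, zero_mul, add_zero]

theorem kr_log_deriv {P : Type*} [Fintype P] (v l m : P → ℝ) (hl : ∀ p, 0 < l p)
    (hm : ∀ p, 0 < m p) (t : ℝ) (ht : 0 ≤ t) :
    HasDerivAt (fun T => ∑ p, v p * (Real.log (l p + T * m p) - Real.log (l p)))
      (∑ p, v p * (m p / (l p + t * m p))) t := by
  apply HasDerivAt.fun_sum
  intro p _
  apply HasDerivAt.const_mul
  apply HasDerivAt.sub_const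
  have h1 : HasDerivAt (fun T => l p + T * m p) (m p) t := by
    simpa using ((hasDerivAt_id t).mul_const (m p)).const_add (l p)
  have hne : l p + t * m p ≠ 0 := by
    have := hl p
    have := hm p
    positivity
  exact h1.log hne

theorem kr_key {P : Type*} [Fintype P] (w l m : P → ℝ) (hl : ∀ p, 0 < l p) (hm : ∀ p, 0 < m p)
    (hD : ∀ t, 0 < t → 0 ≤ ∑ p, w p * (m p ^ 2 / (l p + t * m p)))
    (h0 : ∑ p, w p * m p = 0) (h1 : ∑ p, w p * l p = 0) :
    0 ≤ ∑ p, w p * (l p * (Real.log (l p) - Real.log (m p))) ∧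
    0 ≤ ∑ p, w p * (m p * (Real.log (m p) - Real.log (l p))) ∧
    (∑ p, w p * (l p * (Real.log (l p) - Real.log (m p))) = 0 ↔
      ∑ p, w p * (m p * (Real.log (m p) - Real.log (l p))) = 0) := by
  have A := kr_mono_lim _ (fun t => ∑ p, w p * (m p ^ 2 / (l p + t * m p))) _
    (fun t ht => by
      convert kr_log_deriv (fun p => w p * m p) l m hl hm t ht using 1
      exact Finset.sum_congr rfl fun p _ => by ring)
    hD (by simp) (kr_log_lim (fun p => w p * m p) l m hl hm h0)
  have B := kr_mono_lim _ (fun t => t * ∑ p, w p * (m p ^ 2 / (l p + t * m p))) _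
    (fun t ht => by
      convert kr_log_deriv (fun p => -(w p * l p)) l m hl hm t ht using 1
      have : ∑ p, -(w p * l p) * (m p / (l p + t * m p)) =
        ∑ p, -(w p * l p) * (m p / (l p + t * m p)) + ∑ p, w p * m p := by rw [h0, add_zero]
      rw [this, Finset.mul_sum, ← Finset.sum_add_distrib]
      refine Finset.sum_congr rfl fun p _ => ?_
      have hne : l p + t * m p ≠ 0 := by
        have := hl p
        have := hm p
        positivity
      field_simp
      ring)
    (fun t ht => mul_nonneg ht.le (hD t ht)) (by simp)
    (kr_log_lim (fun p => -(w p * l p)) l m hl hm (by simp [h1]))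
  have e1 : ∑ p, w p * (l p * (Real.log (l p) - Real.log (m p))) =
      ∑ p, -(w p * l p) * (Real.log (m p) - Real.log (l p)) :=
    Finset.sum_congr rfl fun p _ => by ring
  have e2 : ∑ p, w p * (m p * (Real.log (m p) - Real.log (l p))) =
      ∑ p, (w p * m p) * (Real.log (m p) - Real.log (l p)) :=
    Finset.sum_congr rfl fun p _ => by ring
  rw [e1, e2]
  refine ⟨B.1, A.1, ?_⟩
  rw [A.2, B.2]
  refine forall_congr' fun t => forall_congr' fun ht => ?_
  simp [ht.ne']

set_option linter.unusedSectionVars false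

section KRMatrix

variable {n m : Type*} [Fintype n] [Fintype m] [DecidableEq n] [DecidableEq m]

/-- `K` in the eigenbases of `L` (left) and `R` (right) -/
noncomputable def krTilde {L : Matrix n n ℂ} {R : Matrix m m ℂ} (hL : L.IsHermitian)
    (hR : R.IsHermitian) (K : Matrix n m ℂ) : Matrix n m ℂ :=
  star (hL.eigenvectorUnitary : Matrix n n ℂ) * K * (hR.eigenvectorUnitary : Matrix m m ℂ)

theorem kr_UU {L : Matrix n n ℂ} (hL : L.IsHermitian) :
    star (hL.eigenvectorUnitary : Matrix n n ℂ) * (hL.eigenvectorUnitary : Matrix n n ℂ) = 1 :=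
  Unitary.coe_star_mul_self _

theorem kr_UU' {L : Matrix n n ℂ} (hL : L.IsHermitian) :
    (hL.eigenvectorUnitary : Matrix n n ℂ) * star (hL.eigenvectorUnitary : Matrix n n ℂ) = 1 :=
  Unitary.coe_mul_star_self _

theorem kr_matFun_id {L : Matrix n n ℂ} (hL : L.IsHermitian) : matFun (fun x => x) L = L := by
  have := hL.spectral_theorem
  rw [Unitary.conjStarAlgAut_apply] at this
  rw [matFun, dif_pos hL]
  conv_rhs => rw [this]
  rfl

theorem kr_matFun_one {L : Matrix n n ℂ} (hL : L.IsHermitian) : matFun (fun _ => 1) L = 1 := by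
  rw [matFun, dif_pos hL]
  simp [kr_UU' hL]

theorem kr_matFun_mul {L : Matrix n n ℂ} (hL : L.IsHermitian) (f g : ℝ → ℝ) :
    matFun f L * matFun g L = matFun (fun x => f x * g x) L := by
  simp only [matFun, dif_pos hL]
  set U := (hL.eigenvectorUnitary : Matrix n n ℂ)
  set D := Matrix.diagonal (fun i => (f (hL.eigenvalues i) : ℂ))
  set E := Matrix.diagonal (fun i => (g (hL.eigenvalues i) : ℂ))
  have : U * D * star U * (U * E * star U) = U * D * (star U * U) * E * star U := by
    simp only [Matrix.mul_assoc]
  rw [this, kr_UU hL, Matrix.mul_one, Matrix.mul_assoc U D E, Matrix.diagonal_mul_diagonal]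
  simp

theorem kr_trace {L : Matrix n n ℂ} {R : Matrix m m ℂ} (hL : L.IsHermitian)
    (hR : R.IsHermitian) (Y K : Matrix n m ℂ) (f g : ℝ → ℝ) :
    (matFun f R * (Yᴴ * (matFun g L * K))).trace =
      ∑ i, ∑ j, ((g (hL.eigenvalues i) * f (hR.eigenvalues j) : ℝ) : ℂ) *
        (star (krTilde hL hR Y i j) * krTilde hL hR K i j) := by
  have h : (matFun f R * (Yᴴ * (matFun g L * K))).trace =
      (Matrix.diagonal (fun i => (f (hR.eigenvalues i) : ℂ)) * (krTilde hL hR Y)ᴴ *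
        (Matrix.diagonal (fun i => (g (hL.eigenvalues i) : ℂ)) * krTilde hL hR K)).trace := by
    simp only [matFun, dif_pos hL, dif_pos hR, krTilde]
    rw [Matrix.mul_assoc, Matrix.mul_assoc, Matrix.trace_mul_comm]
    simp only [Matrix.conjTranspose_mul, Matrix.mul_assoc, Matrix.star_eq_conjTranspose,
      Matrix.conjTranspose_conjTranspose]
  rw [h]
  simp only [Matrix.trace, Matrix.diag, Matrix.mul_apply (M := Matrix.diagonal _ * _),
    Matrix.diagonal_mul, Matrix.conjTranspose_apply]
  rw [Finset.sum_comm]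
  refine Finset.sum_congr rfl fun i _ => Finset.sum_congr rfl fun j _ => ?_
  push_cast
  ring

theorem kr_trace_self {L : Matrix n n ℂ} {R : Matrix m m ℂ} (hL : L.IsHermitian)
    (hR : R.IsHermitian) (K : Matrix n m ℂ) (f g : ℝ → ℝ) :
    (matFun f R * (Kᴴ * (matFun g L * K))).trace =
      ((∑ i, ∑ j, Complex.normSq (krTilde hL hR K i j) *
        (g (hL.eigenvalues i) * f (hR.eigenvalues j)) : ℝ) : ℂ) := by
  rw [kr_trace hL hR]
  push_cast
  refine Finset.sum_congr rfl fun i _ => Finset.sum_congr rfl fun j _ => ?_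
  rw [Complex.normSq_eq_conj_mul_self, mul_comm]
  rfl

/-- `Tr K* L (log L - log R) K` -/
noncomputable def krS1 {L : Matrix n n ℂ} {R : Matrix m m ℂ} (hL : L.IsHermitian)
    (hR : R.IsHermitian) (K : Matrix n m ℂ) : ℝ :=
  ∑ i, ∑ j, Complex.normSq (krTilde hL hR K i j) * (hL.eigenvalues i *
    (Real.log (hL.eigenvalues i) - Real.log (hR.eigenvalues j)))

/-- `Tr R (log R - log L)` -/
noncomputable def krS2 {L : Matrix n n ℂ} {R : Matrix m m ℂ} (hL : L.IsHermitian)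
    (hR : R.IsHermitian) (K : Matrix n m ℂ) : ℝ :=
  ∑ i, ∑ j, Complex.normSq (krTilde hL hR K i j) * (hR.eigenvalues j *
    (Real.log (hR.eigenvalues j) - Real.log (hL.eigenvalues i)))

theorem krS1_eq {L : Matrix n n ℂ} {R : Matrix m m ℂ} (hL : L.IsHermitian)
    (hR : R.IsHermitian) (K : Matrix n m ℂ) :
    (krS1 hL hR K : ℂ) =
      (Kᴴ * (L * matLog L * K)).trace - (matLog R * (Kᴴ * (L * K))).trace := by
  have h1 : L * matLog L = matFun (fun x => x * Real.log x) L := by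
    nth_rewrite 1 [← kr_matFun_id hL]
    exact kr_matFun_mul hL _ _
  have h2 := kr_trace_self hL hR K (fun _ => 1) (fun x => x * Real.log x)
  rw [kr_matFun_one hR, Matrix.one_mul] at h2
  have h3 := kr_trace_self hL hR K Real.log (fun x => x)
  rw [kr_matFun_id hL] at h3
  rw [h1, h2, matLog, h3, krS1, ← Complex.ofReal_sub, ← Finset.sum_sub_distrib]
  congr 1
  refine Finset.sum_congr rfl fun i _ => ?_
  rw [← Finset.sum_sub_distrib]
  refine Finset.sum_congr rfl fun j _ => ?_
  ring

theorem krS2_eq {L : Matrix n n ℂ} {R : Matrix m m ℂ} (hL : L.IsHermitian)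
    (hR : R.IsHermitian) (K : Matrix n m ℂ) :
    (krS2 hL hR K : ℂ) =
      (matLog R * R * (Kᴴ * K)).trace - (R * (Kᴴ * (matLog L * K))).trace := by
  have h1 : matLog R * R = matFun (fun x => Real.log x * x) R := by
    nth_rewrite 2 [← kr_matFun_id hR]
    exact kr_matFun_mul hR _ _
  have h2 := kr_trace_self hL hR K (fun x => Real.log x * x) (fun _ => 1)
  rw [kr_matFun_one hL, Matrix.one_mul] at h2
  have h3 := kr_trace_self hL hR K (fun x => x) Real.log
  rw [kr_matFun_id hR] at h3
  rw [h1, h2, matLog, h3, krS2, ← Complex.ofReal_sub, ← Finset.sum_sub_distrib]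
  congr 1
  refine Finset.sum_congr rfl fun i _ => ?_
  rw [← Finset.sum_sub_distrib]
  refine Finset.sum_congr rfl fun j _ => ?_
  ring

/-- The resolvent quadratic form. -/
noncomputable def krQ {L : Matrix n n ℂ} {R : Matrix m m ℂ} (hL : L.IsHermitian)
    (hR : R.IsHermitian) (K : Matrix n m ℂ) (t : ℝ) : ℝ :=
  ∑ i, ∑ j, Complex.normSq (krTilde hL hR K i j) *
    (hR.eigenvalues j ^ 2 / (hL.eigenvalues i + t * hR.eigenvalues j))

/-- The variational functional. -/
noncomputable def krV (L : Matrix n n ℂ) (R : Matrix m m ℂ) (K Y : Matrix n m ℂ) (t : ℝ) : ℝ :=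
  2 * (R * (Yᴴ * K)).trace.re - (Yᴴ * (L * Y)).trace.re - t * (R * (Yᴴ * Y)).trace.re

theorem krV_eq {L : Matrix n n ℂ} {R : Matrix m m ℂ} (hL : L.IsHermitian)
    (hR : R.IsHermitian) (K Y : Matrix n m ℂ) (t : ℝ) :
    krV L R K Y t = ∑ i, ∑ j, (2 * (hR.eigenvalues j *
      (star (krTilde hL hR Y i j) * krTilde hL hR K i j).re) -
      (hL.eigenvalues i + t * hR.eigenvalues j) * Complex.normSq (krTilde hL hR Y i j)) := by
  have h1 := kr_trace hL hR Y K (fun x => x) (fun _ => 1)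
  have h2 := kr_trace_self hL hR Y (fun _ => 1) (fun x => x)
  have h3 := kr_trace_self hL hR Y (fun x => x) (fun _ => 1)
  rw [kr_matFun_one hL, kr_matFun_id hR, Matrix.one_mul] at h1 h3
  rw [kr_matFun_one hR, kr_matFun_id hL, Matrix.one_mul] at h2
  rw [krV, h1, h2, h3, Complex.ofReal_re, Complex.ofReal_re]
  simp only [Complex.re_sum, Complex.re_ofReal_mul, Finset.mul_sum, ← Finset.sum_sub_distrib]
  refine Finset.sum_congr rfl fun i _ => Finset.sum_congr rfl fun j _ => ?_
  ring

theorem kr_scalar (l m t : ℝ) (h : 0 < l + t * m) (y k : ℂ) :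
    2 * (m * (star y * k).re) - (l + t * m) * Complex.normSq y ≤
      Complex.normSq k * (m ^ 2 / (l + t * m)) := by
  have : Complex.normSq k * (m ^ 2 / (l + t * m)) = (Complex.normSq k * m ^ 2) / (l + t * m) := by
    ring
  rw [this, le_div_iff₀ h]
  simp only [Complex.normSq_apply, Complex.mul_re, Complex.star_def, Complex.conj_re,
    Complex.conj_im]
  nlinarith [sq_nonneg ((l + t * m) * y.re - m * k.re), sq_nonneg ((l + t * m) * y.im - m * k.im)]

theorem krV_le {L : Matrix n n ℂ} {R : Matrix m m ℂ} (hL : L.PosDef)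
    (hR : R.PosDef) (K Y : Matrix n m ℂ) (t : ℝ) (ht : 0 < t) :
    krV L R K Y t ≤ krQ hL.1 hR.1 K t := by
  rw [krV_eq hL.1 hR.1, krQ]
  refine Finset.sum_le_sum fun i _ => Finset.sum_le_sum fun j _ => ?_
  apply kr_scalar
  have := hL.eigenvalues_pos i
  have := hR.eigenvalues_pos j
  positivity

theorem krV_exists {L : Matrix n n ℂ} {R : Matrix m m ℂ} (hL : L.PosDef)
    (hR : R.PosDef) (K : Matrix n m ℂ) (t : ℝ) (ht : 0 < t) :
    ∃ Y, krV L R K Y t = krQ hL.1 hR.1 K t := by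
  let Z : Matrix n m ℂ := fun i j => ((hR.1.eigenvalues j /
    (hL.1.eigenvalues i + t * hR.1.eigenvalues j) : ℝ) : ℂ) * krTilde hL.1 hR.1 K i j
  refine ⟨(hL.1.eigenvectorUnitary : Matrix n n ℂ) * Z *
    star (hR.1.eigenvectorUnitary : Matrix m m ℂ), ?_⟩
  have hZ : krTilde hL.1 hR.1 ((hL.1.eigenvectorUnitary : Matrix n n ℂ) * Z *
    star (hR.1.eigenvectorUnitary : Matrix m m ℂ)) = Z := by
    rw [krTilde, Matrix.mul_assoc, Matrix.mul_assoc, kr_UU hR.1, Matrix.mul_one, ← Matrix.mul_assoc,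
      kr_UU hL.1, Matrix.one_mul]
  rw [krV_eq hL.1 hR.1, krQ, hZ]
  refine Finset.sum_congr rfl fun i _ => Finset.sum_congr rfl fun j _ => ?_
  have h1 := hL.eigenvalues_pos i
  have h2 := hR.eigenvalues_pos j
  have h3 : hL.1.eigenvalues i + t * hR.1.eigenvalues j ≠ 0 := by positivity
  simp only [Z, map_mul, star_mul', Complex.normSq_ofReal, Complex.star_def, Complex.conj_ofReal,
    mul_assoc, Complex.re_ofReal_mul]
  rw [← Complex.normSq_eq_conj_mul_self, Complex.ofReal_re]
  field_simp
  ring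

end KRMatrix

section KRDpi

open scoped Kronecker

variable {X p q : Type*} [Fintype X] [Fintype p] [Fintype q] [DecidableEq X] [DecidableEq p]
  [DecidableEq q]

/-- `id_X ⊗ Z` -/
noncomputable def krI (X : Type*) [DecidableEq X] (Z : Matrix p q ℂ) : Matrix (X × p) (X × q) ℂ :=
  (1 : Matrix X X ℂ) ⊗ₖ Z

theorem krI_conj (Z : Matrix p q ℂ) : (krI X Z)ᴴ = krI X Zᴴ := by
  rw [krI, Matrix.conjTranspose_kronecker, Matrix.conjTranspose_one, krI]

theorem krI_mul {r : Type*} [Fintype r] (Z : Matrix p q ℂ) (W : Matrix q r ℂ) :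
    krI X Z * krI X W = krI X (Z * W) := by
  rw [krI, krI, krI, ← Matrix.mul_kronecker_mul, Matrix.one_mul]

theorem krI_trace (M : Matrix (X × p) (X × p) ℂ) (Z : Matrix p p ℂ) :
    (M * krI X Z).trace = (bptFst M * Z).trace := by
  simp only [Matrix.trace, Matrix.diag, Matrix.mul_apply, krI, Matrix.kroneckerMap_apply,
    Fintype.sum_prod_type, Matrix.one_apply, bptFst, Finset.sum_mul, ite_mul, mul_ite, one_mul,
    zero_mul, mul_zero]
  rw [Finset.sum_comm]
  refine Finset.sum_congr rfl fun i _ => ?_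
  rw [Finset.sum_comm]
  simp
  rw [Finset.sum_comm]

theorem krV_krI (L : Matrix (X × p) (X × p) ℂ) (R : Matrix (X × q) (X × q) ℂ) (K Y : Matrix p q ℂ)
    (t : ℝ) : krV L R (krI X K) (krI X Y) t = krV (bptFst L) (bptFst R) K Y t := by
  have h : ∀ (L : Matrix (X × p) (X × p) ℂ), ((krI X Y)ᴴ * (L * krI X Y)).trace =
      (Yᴴ * (bptFst L * Y)).trace := by
    intro L
    rw [Matrix.trace_mul_comm, Matrix.mul_assoc, krI_conj, krI_mul, krI_trace,
      ← Matrix.mul_assoc, Matrix.trace_mul_comm]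
  rw [krV, h, krI_conj, krI_mul, krI_mul, krI_trace, krI_trace]
  rfl

theorem kr_posDef_bptFst [Nonempty X] {L : Matrix (X × p) (X × p) ℂ} (hL : L.PosDef) :
    (bptFst L).PosDef := by
  have : bptFst L = ∑ x : X, L.submatrix (fun b => (x, b)) (fun b => (x, b)) := by
    ext b b'
    simp [bptFst, Matrix.sum_apply]
  rw [this]
  apply Matrix.posDef_sum Finset.univ_nonempty
  intro x _
  exact hL.submatrix fun a b h => (Prod.mk.inj h).2

theorem kr_dpi {L : Matrix (X × p) (X × p) ℂ} {R : Matrix (X × q) (X × q) ℂ}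
    {L' : Matrix p p ℂ} {R' : Matrix q q ℂ}
    (hL : L.PosDef) (hR : R.PosDef) (hL' : L'.PosDef) (hR' : R'.PosDef)
    (eL : L' = bptFst L) (eR : R' = bptFst R) (K : Matrix p q ℂ) :
    0 ≤ krS1 hL.1 hR.1 (krI X K) - krS1 hL'.1 hR'.1 K ∧
    0 ≤ krS2 hL.1 hR.1 (krI X K) - krS2 hL'.1 hR'.1 K ∧
    (krS1 hL.1 hR.1 (krI X K) - krS1 hL'.1 hR'.1 K = 0 ↔
      krS2 hL.1 hR.1 (krI X K) - krS2 hL'.1 hR'.1 K = 0) := by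
  have hQ : ∀ t, 0 < t → krQ hL'.1 hR'.1 K t ≤ krQ hL.1 hR.1 (krI X K) t := by
    intro t ht
    obtain ⟨Y, hY⟩ := krV_exists hL' hR' K t ht
    rw [← hY, eL, eR, ← krV_krI]
    exact krV_le hL hR _ _ t ht
  have h0 : (∑ i, ∑ j, Complex.normSq (krTilde hL.1 hR.1 (krI X K) i j) * (hR.1.eigenvalues j)) =
      ∑ i, ∑ j, Complex.normSq (krTilde hL'.1 hR'.1 K i j) * (hR'.1.eigenvalues j) := by
    have a := kr_trace_self hL.1 hR.1 (krI X K) (fun x => x) (fun _ => 1)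
    have b := kr_trace_self hL'.1 hR'.1 K (fun x => x) (fun _ => 1)
    rw [kr_matFun_one hL.1, Matrix.one_mul, kr_matFun_id hR.1, krI_conj, krI_mul, krI_trace] at a
    rw [kr_matFun_one hL'.1, Matrix.one_mul, kr_matFun_id hR'.1] at b
    rw [← eR] at a
    simpa only [one_mul] using Complex.ofReal_injective (a.symm.trans b)
  have h1 : (∑ i, ∑ j, Complex.normSq (krTilde hL.1 hR.1 (krI X K) i j) * (hL.1.eigenvalues i)) =
      ∑ i, ∑ j, Complex.normSq (krTilde hL'.1 hR'.1 K i j) * (hL'.1.eigenvalues i) := by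
    have a := kr_trace_self hL.1 hR.1 (krI X K) (fun _ => 1) (fun x => x)
    have b := kr_trace_self hL'.1 hR'.1 K (fun _ => 1) (fun x => x)
    rw [kr_matFun_one hR.1, Matrix.one_mul, kr_matFun_id hL.1, Matrix.trace_mul_comm,
      Matrix.mul_assoc, krI_conj, krI_mul, krI_trace] at a
    rw [kr_matFun_one hR'.1, Matrix.one_mul, kr_matFun_id hL'.1, Matrix.trace_mul_comm,
      Matrix.mul_assoc] at b
    rw [← eL] at a
    simpa only [mul_one] using Complex.ofReal_injective (a.symm.trans b)
  have key := kr_key (P := ((X × p) × (X × q)) ⊕ (p × q))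
    (Sum.elim (fun z => Complex.normSq (krTilde hL.1 hR.1 (krI X K) z.1 z.2))
      (fun z => -Complex.normSq (krTilde hL'.1 hR'.1 K z.1 z.2)))
    (Sum.elim (fun z => hL.1.eigenvalues z.1) (fun z => hL'.1.eigenvalues z.1))
    (Sum.elim (fun z => hR.1.eigenvalues z.2) (fun z => hR'.1.eigenvalues z.2))
    (by rintro (z | z); exacts [hL.eigenvalues_pos _, hL'.eigenvalues_pos _])
    (by rintro (z | z); exacts [hR.eigenvalues_pos _, hR'.eigenvalues_pos _])
  simp only [krQ, Fintype.sum_prod_type] at hQ h0 h1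
  simp only [krS1, krS2, Fintype.sum_prod_type]
  simp only [Fintype.sum_sum_type, Sum.elim_inl, Sum.elim_inr, neg_mul, Finset.sum_neg_distrib,
    ← sub_eq_add_neg, Fintype.sum_prod_type] at key
  exact key (fun t ht => sub_nonneg.2 (hQ t ht)) (sub_eq_zero.2 h0) (sub_eq_zero.2 h1)

end KRDpi

theorem kr_isHermitian {n : Type*} [Fintype n] [DecidableEq n] (M : Matrix n n ℂ)
    (h : ∀ x : n → ℂ, ∃ r : ℝ, star x ⬝ᵥ (M *ᵥ x) = r) : M.IsHermitian := by
  rw [← Matrix.isSymmetric_toEuclideanLin_iff, LinearMap.isSymmetric_iff_inner_map_self_real]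
  intro v
  obtain ⟨r, hr⟩ := h v.ofLp
  have : inner ℂ (Matrix.toEuclideanLin M v) v = (r : ℂ) := by
    rw [← inner_conj_symm, EuclideanSpace.inner_eq_star_dotProduct]
    rw [dotProduct_comm]
    have e : (Matrix.toEuclideanLin M v).ofLp = M *ᵥ v.ofLp := rfl
    rw [e, hr, Complex.conj_ofReal]
  rw [this, Complex.conj_ofReal]

theorem kr_psd {n : Type*} [Fintype n] [DecidableEq n] (M : Matrix n n ℂ) (r : (n → ℂ) → ℝ)
    (h : ∀ x : n → ℂ, star x ⬝ᵥ (M *ᵥ x) = r x) (h0 : ∀ x, 0 ≤ r x) :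
    M.PosSemidef ∧ (M = 0 ↔ ∀ x, r x = 0) := by
  have hp : M.PosSemidef := by
    refine .of_dotProduct_mulVec_nonneg (kr_isHermitian M fun x => ⟨_, h x⟩) fun x => ?_
    rw [h]
    exact_mod_cast h0 x
  refine ⟨hp, ?_, ?_⟩
  · intro hM x
    have := h x
    rw [hM, Matrix.zero_mulVec, dotProduct_zero] at this
    exact_mod_cast this.symm
  · intro hr
    have : ∀ x, M *ᵥ x = 0 := fun x => by
      rw [← hp.dotProduct_mulVec_zero_iff, h, hr, Complex.ofReal_zero]
    ext i j
    have := congrFun (this (Pi.single j 1)) i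
    simpa using this

section KRTri

variable {A B C : Type*} [Fintype A] [Fintype B] [Fintype C]
    [DecidableEq A] [DecidableEq B] [DecidableEq C]

/-- `id_B ⊗ |x⟩` -/
noncomputable def krK (B : Type*) [DecidableEq B] (x : C → ℂ) : Matrix (B × C) B ℂ :=
  fun z b => if z.1 = b then x z.2 else 0

/-- `M ⊗ id_C` -/
noncomputable def krExt (C : Type*) [DecidableEq C] (M : Matrix B B ℂ) :
    Matrix (B × C) (B × C) ℂ :=
  fun z w => M z.1 w.1 * (if z.2 = w.2 then 1 else 0)

theorem kr_extBC (M : Matrix (B × C) (B × C) ℂ) :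
    (extBC M : Matrix (A × B × C) (A × B × C) ℂ) = krI A M := by
  ext x y
  simp [extBC, krI, Matrix.kroneckerMap_apply, Matrix.one_apply]

theorem kr_extB (M : Matrix B B ℂ) :
    (extB M : Matrix (A × B × C) (A × B × C) ℂ) = krI A (krExt C M) := by
  ext x y
  simp [extB, krI, krExt, Matrix.kroneckerMap_apply, Matrix.one_apply, mul_assoc]

theorem kr_ext_mul (M : Matrix B B ℂ) (x : C → ℂ) : krExt C M * krK B x = krK B x * M := by
  ext z b
  simp [krExt, krK, Matrix.mul_apply, Fintype.sum_prod_type, mul_comm]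

theorem kr_extAB_mul (M : Matrix (A × B) (A × B) ℂ) (x : C → ℂ) :
    (extAB M : Matrix (A × B × C) (A × B × C) ℂ) * krI A (krK B x) = krI A (krK B x) * M := by
  ext z b
  obtain ⟨a, b', c⟩ := z
  obtain ⟨a1, b1⟩ := b
  simp [extAB, krI, krK, Matrix.mul_apply, Fintype.sum_prod_type, Matrix.kroneckerMap_apply,
    Matrix.one_apply, mul_comm]

theorem kr_quad (N : Matrix (A × B × C) (A × B × C) ℂ) (x : C → ℂ) :
    star x ⬝ᵥ (ptAB N *ᵥ x) = ((krI A (krK B x))ᴴ * (N * krI A (krK B x))).trace := by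
  have h1 : ∀ z a b, (N * krI A (krK B x)) z (a, b) = ∑ c, N z (a, b, c) * x c := by
    intro z a b
    simp [krI, krK, Matrix.mul_apply, Fintype.sum_prod_type, Matrix.kroneckerMap_apply,
      Matrix.one_apply]
  have h2 : ∀ a b, ((krI A (krK B x))ᴴ * (N * krI A (krK B x))) (a, b) (a, b) =
      ∑ c, star (x c) * ∑ c', N (a, b, c) (a, b, c') * x c' := by
    intro a b
    rw [Matrix.mul_apply]
    simp only [h1, Fintype.sum_prod_type]
    rw [Finset.sum_eq_single a, Finset.sum_eq_single b]
    · simp [krI, krK]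
    · intro b' _ h
      simp [krI, krK, h]
    · simp
    · intro a' _ h
      simp [krI, krK, h]
    · simp
  simp only [Matrix.trace, Matrix.diag, Fintype.sum_prod_type, h2]
  simp only [dotProduct, Matrix.mulVec, ptAB, Finset.sum_mul, Finset.mul_sum, Pi.star_apply]
  simp only [← Fintype.sum_prod_type']
  refine Fintype.sum_equiv
    ⟨fun z => (z.2.2.1, z.2.2.2, z.1, z.2.1), fun z => (z.2.2.1, z.2.2.2, z.1, z.2.1),
      fun _ => rfl, fun _ => rfl⟩ _ _ fun z => rfl

theorem kr_entropy {n : Type*} [Fintype n] [DecidableEq n] {L : Matrix n n ℂ}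
    (hL : L.IsHermitian) : (L * matLog L).trace = ((-vnEntropy L : ℝ) : ℂ) := by
  have h1 : L * matLog L = matFun (fun x => x * Real.log x) L := by
    nth_rewrite 1 [← kr_matFun_id hL]
    exact kr_matFun_mul hL _ _
  rw [h1, matFun, dif_pos hL, Matrix.trace_mul_comm, ← Matrix.mul_assoc, kr_UU hL, Matrix.one_mul,
    Matrix.trace_diagonal, vnEntropy, dif_pos hL]
  simp

theorem kr_ptAB_trace (N : Matrix (A × B × C) (A × B × C) ℂ) : (ptAB N).trace = N.trace := by
  simp only [Matrix.trace, Matrix.diag, ptAB, Fintype.sum_prod_type]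
  rw [Finset.sum_comm]
  exact Finset.sum_congr rfl fun a _ => Finset.sum_comm

theorem kr_extAB_trace (N : Matrix (A × B × C) (A × B × C) ℂ) (M : Matrix (A × B) (A × B) ℂ) :
    (N * extAB M).trace = (ptC N * M).trace := by
  simp only [Matrix.trace, Matrix.diag, Matrix.mul_apply, extAB, ptC, Fintype.sum_prod_type,
    Finset.sum_mul, mul_ite, mul_one, mul_zero, Finset.sum_ite_eq, Finset.sum_ite_eq',
    Finset.mem_univ, if_true]
  refine Finset.sum_congr rfl fun a _ => Finset.sum_congr rfl fun b _ => ?_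
  rw [Finset.sum_comm]
  refine Finset.sum_congr rfl fun a _ => ?_
  rw [Finset.sum_comm]

theorem kr_ext_trace (N : Matrix (B × C) (B × C) ℂ) (M : Matrix B B ℂ) :
    (N * krExt C M).trace = (bptSnd N * M).trace := by
  simp only [Matrix.trace, Matrix.diag, Matrix.mul_apply, krExt, bptSnd, Fintype.sum_prod_type,
    Finset.sum_mul, mul_ite, mul_one, mul_zero, Finset.sum_ite_eq, Finset.sum_ite_eq',
    Finset.mem_univ, if_true]
  refine Finset.sum_congr rfl fun b _ => ?_
  rw [Finset.sum_comm]

theorem kr_posDef_ptC [Nonempty C] {L : Matrix (A × B × C) (A × B × C) ℂ} (hL : L.PosDef) :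
    (ptC L).PosDef := by
  have : ptC L = ∑ c : C, L.submatrix (fun z : A × B => (z.1, z.2, c))
      (fun z : A × B => (z.1, z.2, c)) := by
    ext b b'
    simp [ptC, Matrix.sum_apply]
  rw [this]
  apply Matrix.posDef_sum Finset.univ_nonempty
  intro x _
  refine hL.submatrix fun a b h => ?_
  simp only [Prod.mk.injEq] at h
  exact Prod.ext h.1 h.2.1

theorem kr_M1 {ρ : Matrix (A × B × C) (A × B × C) ℂ} (hL : ρ.IsHermitian)
    (hR : (ptC ρ).IsHermitian) (hL' : (ptA ρ).IsHermitian) (hR' : (ptAC ρ).IsHermitian)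
    (x : C → ℂ) :
    star x ⬝ᵥ (ptAB (ρ * (matLog ρ - extAB (matLog (ptC ρ)) + extB (matLog (ptAC ρ))
          - extBC (matLog (ptA ρ)))) *ᵥ x) =
      ((krS1 hL hR (krI A (krK B x)) - krS1 hL' hR' (krK B x) : ℝ) : ℂ) := by
  have eL : ptA ρ = bptFst ρ := rfl
  rw [Complex.ofReal_sub, krS1_eq, krS1_eq, kr_quad, kr_extB, kr_extBC]
  have t1 : (matLog (ptC ρ) * ((krI A (krK B x))ᴴ * (ρ * krI A (krK B x)))).trace =
      ((krI A (krK B x))ᴴ * (ρ * extAB (matLog (ptC ρ)) * krI A (krK B x))).trace := by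
    rw [Matrix.mul_assoc ρ, kr_extAB_mul, Matrix.trace_mul_comm]
    simp only [Matrix.mul_assoc]
  have t2 : (matLog (ptAC ρ) * ((krK B x)ᴴ * (ptA ρ * krK B x))).trace =
      ((krI A (krK B x))ᴴ * (ρ * krI A (krExt C (matLog (ptAC ρ))) * krI A (krK B x))).trace := by
    rw [Matrix.mul_assoc ρ, krI_mul, kr_ext_mul, Matrix.trace_mul_comm (krI A (krK B x))ᴴ,
      krI_conj, Matrix.mul_assoc ρ, krI_mul, krI_trace, ← eL, Matrix.trace_mul_comm,
      Matrix.mul_assoc, Matrix.trace_mul_comm]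
    simp only [Matrix.mul_assoc]
  have t3 : ((krK B x)ᴴ * (ptA ρ * matLog (ptA ρ) * krK B x)).trace =
      ((krI A (krK B x))ᴴ * (ρ * krI A (matLog (ptA ρ)) * krI A (krK B x))).trace := by
    rw [Matrix.mul_assoc ρ, krI_mul, Matrix.trace_mul_comm (krI A (krK B x))ᴴ,
      krI_conj, Matrix.mul_assoc ρ, krI_mul, krI_trace, ← eL, Matrix.trace_mul_comm]
    simp only [Matrix.mul_assoc]
  rw [t1, t2, t3]
  simp only [Matrix.mul_sub, Matrix.mul_add, Matrix.sub_mul, Matrix.add_mul, Matrix.trace_sub,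
    Matrix.trace_add]
  ring

theorem kr_M2 {ρ : Matrix (A × B × C) (A × B × C) ℂ} (hL : ρ.IsHermitian)
    (hR : (ptC ρ).IsHermitian) (hL' : (ptA ρ).IsHermitian) (hR' : (ptAC ρ).IsHermitian)
    (x : C → ℂ) :
    star x ⬝ᵥ (ptAB (extAB (ptC ρ) * (extAB (matLog (ptC ρ)) - matLog ρ - extB (matLog (ptAC ρ))
          + extBC (matLog (ptA ρ)))) *ᵥ x) =
      ((krS2 hL hR (krI A (krK B x)) - krS2 hL' hR' (krK B x) : ℝ) : ℂ) := by
  have eR : ptAC ρ = bptFst (ptC ρ) := rfl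
  have hE : (extAB (ptC ρ) : Matrix (A × B × C) (A × B × C) ℂ)ᴴ = extAB (ptC ρ) := by
    ext y z
    have := hR.apply (y.1, y.2.1) (z.1, z.2.1)
    simp only [Matrix.conjTranspose_apply, extAB, star_mul', this]
    congr 1
    by_cases h : y.2.2 = z.2.2
    · simp [h]
    · simp [h, Ne.symm h]
  have hK : (krI A (krK B x))ᴴ *
      (extAB (ptC ρ) : Matrix (A × B × C) (A × B × C) ℂ) = ptC ρ * (krI A (krK B x))ᴴ := by
    rw [← hE, ← Matrix.conjTranspose_mul, kr_extAB_mul, Matrix.conjTranspose_mul, hR.eq]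
  rw [Complex.ofReal_sub, krS2_eq, krS2_eq, kr_quad, kr_extB, kr_extBC]
  rw [Matrix.mul_assoc (extAB (ptC ρ)), ← Matrix.mul_assoc (krI A (krK B x))ᴴ, hK,
    Matrix.mul_assoc (ptC ρ)]
  have t1 : (matLog (ptC ρ) * ptC ρ * ((krI A (krK B x))ᴴ * krI A (krK B x))).trace =
      (ptC ρ * ((krI A (krK B x))ᴴ * ((extAB (matLog (ptC ρ)) : Matrix (A × B × C) (A × B × C) ℂ) *
        krI A (krK B x)))).trace := by
    rw [kr_extAB_mul, Matrix.mul_assoc, Matrix.trace_mul_comm]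
    simp only [Matrix.mul_assoc]
  have t2 : (matLog (ptAC ρ) * ptAC ρ * ((krK B x)ᴴ * krK B x)).trace =
      (ptC ρ * ((krI A (krK B x))ᴴ * (krI A (krExt C (matLog (ptAC ρ))) *
        krI A (krK B x)))).trace := by
    rw [krI_mul, kr_ext_mul, krI_conj, krI_mul, krI_trace, ← eR, Matrix.mul_assoc,
      Matrix.trace_mul_comm]
    simp only [Matrix.mul_assoc]
  have t3 : (ptAC ρ * ((krK B x)ᴴ * (matLog (ptA ρ) * krK B x))).trace =
      (ptC ρ * ((krI A (krK B x))ᴴ * (krI A (matLog (ptA ρ)) * krI A (krK B x)))).trace := by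
    rw [krI_mul, krI_conj, krI_mul, krI_trace, ← eR]
  rw [t1, t2, t3]
  simp only [Matrix.mul_sub, Matrix.mul_add, Matrix.sub_mul, Matrix.add_mul, Matrix.trace_sub,
    Matrix.trace_add]
  ring

theorem kr_qcmi {ρ : Matrix (A × B × C) (A × B × C) ℂ} (hL : ρ.IsHermitian)
    (hR : (ptC ρ).IsHermitian) (hL' : (ptA ρ).IsHermitian) (hR' : (ptAC ρ).IsHermitian) :
    (ptAB (ρ * (matLog ρ - extAB (matLog (ptC ρ)) + extB (matLog (ptAC ρ))
          - extBC (matLog (ptA ρ))))).trace = (qcmi ρ : ℂ) := by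
  have eL : bptFst ρ = ptA ρ := rfl
  have eR : bptSnd (ptA ρ) = ptAC ρ := by
    ext b b'
    simp only [bptSnd, ptA, ptAC]
    rw [Finset.sum_comm]
  rw [kr_ptAB_trace, Matrix.mul_sub, Matrix.mul_add, Matrix.mul_sub, Matrix.trace_sub,
    Matrix.trace_add, Matrix.trace_sub, kr_extAB_trace, kr_extB, kr_extBC, krI_trace, krI_trace,
    kr_ext_trace, eL, eR, kr_entropy hL, kr_entropy hR, kr_entropy hL', kr_entropy hR', qcmi]
  push_cast
  ring

end KRTri

/-- (Kim–Ruskai operator inequalities) For an invertible tripartite density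
operator `ρ_ABC`, the partial traces over `AB` of
`ρ_ABC (log ρ_ABC − log ρ_AB + log ρ_B − log ρ_BC)` and of
`ρ_AB (log ρ_AB − log ρ_ABC − log ρ_B + log ρ_BC)` are positive semidefinite operators on
`H_C`, and each vanishes exactly when `I(A:C|B) = 0`. -/
theorem kim_ruskai_operator_inequalities {A B C : Type*} [Fintype A] [Fintype B] [Fintype C]
    [DecidableEq A] [DecidableEq B] [DecidableEq C]
    (ρ : Matrix (A × B × C) (A × B × C) ℂ) (hρ : IsDensity ρ) (hρinv : IsUnit ρ) :
    ∀ M₁ M₂ : Matrix C C ℂ,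
      M₁ = ptAB (ρ * (matLog ρ - extAB (matLog (ptC ρ)) + extB (matLog (ptAC ρ))
          - extBC (matLog (ptA ρ)))) →
      M₂ = ptAB (extAB (ptC ρ) * (extAB (matLog (ptC ρ)) - matLog ρ - extB (matLog (ptAC ρ))
          + extBC (matLog (ptA ρ)))) →
      M₁.PosSemidef ∧ M₂.PosSemidef ∧ (M₁ = 0 ↔ qcmi ρ = 0) ∧ (M₂ = 0 ↔ qcmi ρ = 0) := by
  rintro M₁ M₂ hM₁ hM₂
  have hL : ρ.PosDef := hρ.1.posDef_iff_isUnit.2 hρinv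
  have hne : Nonempty (A × B × C) := by
    by_contra h
    rw [not_nonempty_iff] at h
    have := hρ.2
    simp [Matrix.trace] at this
  obtain ⟨a, b, c⟩ := hne
  have : Nonempty A := ⟨a⟩
  have : Nonempty C := ⟨c⟩
  have hR : (ptC ρ).PosDef := kr_posDef_ptC hL
  have hL' : (ptA ρ).PosDef := kr_posDef_bptFst hL
  have hR' : (ptAC ρ).PosDef := kr_posDef_bptFst hR
  have D := fun x : C → ℂ => kr_dpi hL hR hL' hR' rfl rfl (krK B x)
  have P1 := kr_psd M₁ _ (fun x => by rw [hM₁]; exact kr_M1 hL.1 hR.1 hL'.1 hR'.1 x)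
    (fun x => (D x).1)
  have P2 := kr_psd M₂ _ (fun x => by rw [hM₂]; exact kr_M2 hL.1 hR.1 hL'.1 hR'.1 x)
    (fun x => (D x).2.1)
  have h1 : M₁ = 0 ↔ qcmi ρ = 0 := by
    rw [← P1.1.trace_eq_zero_iff, hM₁, kr_qcmi hL.1 hR.1 hL'.1 hR'.1, Complex.ofReal_eq_zero]
  refine ⟨P1.1, P2.1, h1, ?_⟩
  rw [← h1, P1.2, P2.2]
  exact forall_congr' fun x => (D x).2.2.symm
end

section
/- Let ρ̃_ABC be an invertible density operator on H_A⊗H_B⊗H_C with marginals ρ_AB = Tr_C ρ̃_ABC and ρ_BC = Tr_A ρ̃_ABC, satisfying I_{ρ̃_ABC}(A:C|B) = 0. Then ρ̃_ABC minimizes both sequential Bayesian updating steps: for every density operator σ on H_A⊗H_B⊗H_C with Tr_A σ = ρ_BC one has S(σ || ρ_AB ⊗ id_C/d_C) ≥ S(ρ̃_ABC || ρ_AB ⊗ id_C/d_C), and for every density operator τ with Tr_C τ = ρ_AB one has S(τ || id_A/d_A ⊗ ρ_BC) ≥ S(ρ̃_ABC || id_A/d_A ⊗ ρ_BC). -/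
open scoped Matrix ComplexOrder

variable {A B C : Type*}

section Aux

open Matrix

/-- Unitary diagonalisation as an explicit triple product. -/
lemma aux_spectral {n : Type*} [Fintype n] [DecidableEq n] {ρ : Matrix n n ℂ}
    (h : ρ.IsHermitian) :
    ρ = (h.eigenvectorUnitary : Matrix n n ℂ) *
      Matrix.diagonal (fun i => (h.eigenvalues i : ℂ)) *
        (h.eigenvectorUnitary : Matrix n n ℂ)ᴴ := by
  have := h.spectral_theorem
  rw [Unitary.conjStarAlgAut_apply] at this
  exact this

lemma aux_UU {n : Type*} [Fintype n] [DecidableEq n] {ρ : Matrix n n ℂ}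
    (h : ρ.IsHermitian) :
    (h.eigenvectorUnitary : Matrix n n ℂ)ᴴ * (h.eigenvectorUnitary : Matrix n n ℂ) = 1 :=
  Unitary.coe_star_mul_self h.eigenvectorUnitary

lemma aux_UU' {n : Type*} [Fintype n] [DecidableEq n] {ρ : Matrix n n ℂ}
    (h : ρ.IsHermitian) :
    (h.eigenvectorUnitary : Matrix n n ℂ) * (h.eigenvectorUnitary : Matrix n n ℂ)ᴴ = 1 :=
  Unitary.coe_mul_star_self h.eigenvectorUnitary

lemma aux_matFun {n : Type*} [Fintype n] [DecidableEq n] {ρ : Matrix n n ℂ}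
    (h : ρ.IsHermitian) (f : ℝ → ℝ) :
    matFun f ρ = (h.eigenvectorUnitary : Matrix n n ℂ) *
      Matrix.diagonal (fun i => (f (h.eigenvalues i) : ℂ)) *
        (h.eigenvectorUnitary : Matrix n n ℂ)ᴴ := by
  rw [matFun, dif_pos h]; rfl

lemma aux_matFun_cfc {n : Type*} [Fintype n] [DecidableEq n] {ρ : Matrix n n ℂ}
    (h : ρ.IsHermitian) (f : ℝ → ℝ) : matFun f ρ = cfc f ρ := by
  rw [h.cfc_eq, aux_matFun h, Matrix.IsHermitian.cfc, Unitary.conjStarAlgAut_apply]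
  rfl

/-- The overlap matrix between two eigenbases. -/
noncomputable def ovl {n : Type*} [Fintype n] [DecidableEq n] {ρ σ : Matrix n n ℂ}
    (hρ : ρ.IsHermitian) (hσ : σ.IsHermitian) : Matrix n n ℂ :=
  (hσ.eigenvectorUnitary : Matrix n n ℂ)ᴴ * (hρ.eigenvectorUnitary : Matrix n n ℂ)

lemma aux_trace_diag {n : Type*} [Fintype n] [DecidableEq n] (p f : n → ℝ) (W : Matrix n n ℂ) :
    ((Matrix.diagonal (fun i => (p i : ℂ)) * Wᴴ * Matrix.diagonal (fun i => (f i : ℂ)) * W).trace).re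
      = ∑ i, ∑ j, Complex.normSq (W j i) * (p i * f j) := by
  simp only [Matrix.trace, Matrix.diag, Matrix.mul_apply (M := _ * _ * _) (N := W),
    Matrix.mul_diagonal, Matrix.diagonal_mul, Matrix.conjTranspose_apply, Complex.re_sum]
  refine Finset.sum_congr rfl fun i _ => Finset.sum_congr rfl fun j _ => ?_
  have : (p i : ℂ) * star (W j i) * (f j : ℂ) * W j i =
      ((Complex.normSq (W j i) * (p i * f j) : ℝ) : ℂ) := by
    push_cast
    rw [Complex.normSq_eq_conj_mul_self]
    simp only [Complex.star_def]
    ring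
  rw [this, Complex.ofReal_re]

lemma aux_trace_matFun {n : Type*} [Fintype n] [DecidableEq n] {ρ σ : Matrix n n ℂ}
    (hρ : ρ.IsHermitian) (hσ : σ.IsHermitian) (f : ℝ → ℝ) :
    ((ρ * matFun f σ).trace).re = ∑ i, ∑ j, Complex.normSq (ovl hρ hσ j i) *
      (hρ.eigenvalues i * f (hσ.eigenvalues j)) := by
  rw [← aux_trace_diag hρ.eigenvalues (fun j => f (hσ.eigenvalues j)), aux_matFun hσ]
  conv_lhs => rw [aux_spectral hρ]
  simp only [ovl, conjTranspose_mul, conjTranspose_conjTranspose]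
  simp only [Matrix.mul_assoc]
  rw [Matrix.trace_mul_comm]
  simp only [Matrix.mul_assoc]

lemma aux_ovl_unit {n : Type*} [Fintype n] [DecidableEq n] {ρ σ : Matrix n n ℂ}
    (hρ : ρ.IsHermitian) (hσ : σ.IsHermitian) : (ovl hρ hσ)ᴴ * ovl hρ hσ = 1 := by
  simp only [ovl, conjTranspose_mul, conjTranspose_conjTranspose]
  rw [Matrix.mul_assoc, ← Matrix.mul_assoc _ _ (hρ.eigenvectorUnitary : Matrix n n ℂ),
    aux_UU' hσ, Matrix.one_mul, aux_UU hρ]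

lemma aux_ovl_unit' {n : Type*} [Fintype n] [DecidableEq n] {ρ σ : Matrix n n ℂ}
    (hρ : ρ.IsHermitian) (hσ : σ.IsHermitian) : ovl hρ hσ * (ovl hρ hσ)ᴴ = 1 :=
  mul_eq_one_comm.mp (aux_ovl_unit hρ hσ)

lemma aux_ovl_sum {n : Type*} [Fintype n] [DecidableEq n] {ρ σ : Matrix n n ℂ}
    (hρ : ρ.IsHermitian) (hσ : σ.IsHermitian) (i : n) :
    ∑ j, Complex.normSq (ovl hρ hσ j i) = 1 := by
  have := congrFun (congrFun (aux_ovl_unit hρ hσ) i) i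
  simp only [Matrix.mul_apply, conjTranspose_apply, Complex.star_def, Matrix.one_apply_eq,
    ← Complex.normSq_eq_conj_mul_self] at this
  exact_mod_cast this

lemma aux_ovl_sum' {n : Type*} [Fintype n] [DecidableEq n] {ρ σ : Matrix n n ℂ}
    (hρ : ρ.IsHermitian) (hσ : σ.IsHermitian) (j : n) :
    ∑ i, Complex.normSq (ovl hρ hσ j i) = 1 := by
  have := congrFun (congrFun (aux_ovl_unit' hρ hσ) j) j
  simp only [Matrix.mul_apply, conjTranspose_apply, Complex.star_def, Matrix.one_apply_eq,
    Complex.mul_conj] at this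
  exact_mod_cast this

lemma aux_trace_self {n : Type*} [Fintype n] [DecidableEq n] {ρ : Matrix n n ℂ}
    (hρ : ρ.IsHermitian) (f : ℝ → ℝ) :
    ((ρ * matFun f ρ).trace).re = ∑ i, hρ.eigenvalues i * f (hρ.eigenvalues i) := by
  rw [aux_trace_matFun hρ hρ]
  have : ovl hρ hρ = 1 := aux_UU hρ
  rw [this]
  refine Finset.sum_congr rfl fun i _ => ?_
  rw [Finset.sum_eq_single i]
  · simp
  · intro j _ hj; simp [Matrix.one_apply_ne hj]
  · simp

lemma aux_vn {n : Type*} [Fintype n] [DecidableEq n] {ρ : Matrix n n ℂ}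
    (hρ : ρ.IsHermitian) : vnEntropy ρ = - ((ρ * matLog ρ).trace).re := by
  rw [matLog, aux_trace_self hρ, vnEntropy, dif_pos hρ]

lemma aux_trace_eig {n : Type*} [Fintype n] [DecidableEq n] {ρ : Matrix n n ℂ}
    (hρ : ρ.IsHermitian) : ρ.trace.re = ∑ i, hρ.eigenvalues i := by
  rw [hρ.trace_eq_sum_eigenvalues]; simp

lemma aux_rel {n : Type*} [Fintype n] [DecidableEq n] {ρ σ : Matrix n n ℂ}
    (hρ : ρ.IsHermitian) (hσ : σ.IsHermitian) :
    relEntropy ρ σ = ∑ i, ∑ j, Complex.normSq (ovl hρ hσ j i) *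
      (hρ.eigenvalues i * (Real.log (hρ.eigenvalues i) - Real.log (hσ.eigenvalues j))) := by
  rw [relEntropy, Matrix.mul_sub, Matrix.trace_sub, Complex.sub_re, matLog, matLog,
    aux_trace_self hρ, aux_trace_matFun hρ hσ, ← Finset.sum_sub_distrib]
  refine Finset.sum_congr rfl fun i _ => ?_
  rw [← one_mul (hρ.eigenvalues i * Real.log (hρ.eigenvalues i)), ← aux_ovl_sum hρ hσ i,
    Finset.sum_mul, ← Finset.sum_sub_distrib]
  refine Finset.sum_congr rfl fun j _ => ?_
  ring

/-- Klein's inequality. -/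
lemma aux_klein {n : Type*} [Fintype n] [DecidableEq n] {ρ σ : Matrix n n ℂ}
    (hρ : ρ.PosSemidef) (hσ : σ.PosDef) (htr : ρ.trace = σ.trace) : 0 ≤ relEntropy ρ σ := by
  rw [aux_rel hρ.1 hσ.1]
  have key : ∀ i j, Complex.normSq (ovl hρ.1 hσ.1 j i) * (hρ.1.eigenvalues i - hσ.1.eigenvalues j)
      ≤ Complex.normSq (ovl hρ.1 hσ.1 j i) * (hρ.1.eigenvalues i *
        (Real.log (hρ.1.eigenvalues i) - Real.log (hσ.1.eigenvalues j))) := by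
    intro i j
    refine mul_le_mul_of_nonneg_left ?_ (Complex.normSq_nonneg _)
    have hq := hσ.eigenvalues_pos j
    rcases (hρ.eigenvalues_nonneg i).eq_or_lt with h0 | hp
    · rw [← h0]; simp [hq.le]
    · have h1 := Real.log_le_sub_one_of_pos (div_pos hq hp)
      rw [Real.log_div hq.ne' hp.ne'] at h1
      have h2 := mul_le_mul_of_nonneg_left h1 hp.le
      have h3 : hρ.1.eigenvalues i * (hσ.1.eigenvalues j / hρ.1.eigenvalues i - 1)
        = hσ.1.eigenvalues j - hρ.1.eigenvalues i := by field_simp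
      rw [h3] at h2
      linarith
  refine le_trans ?_ (Finset.sum_le_sum fun i _ => Finset.sum_le_sum fun j _ => key i j)
  simp only [mul_sub, Finset.sum_sub_distrib]
  have e1 : ∑ i, ∑ j, Complex.normSq (ovl hρ.1 hσ.1 j i) * hρ.1.eigenvalues i = ρ.trace.re := by
    rw [aux_trace_eig hρ.1]
    simp only [← Finset.sum_mul, aux_ovl_sum, one_mul]
  have e2 : ∑ i, ∑ j, Complex.normSq (ovl hρ.1 hσ.1 j i) * hσ.1.eigenvalues j = σ.trace.re := by
    rw [aux_trace_eig hσ.1, Finset.sum_comm]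
    simp only [← Finset.sum_mul, aux_ovl_sum', one_mul]
  rw [e1, e2, htr]; simp

/-- The variational functional. -/
noncomputable def vfun {n : Type*} [Fintype n] (ρ σ : Matrix n n ℂ) (t : ℝ) (X : Matrix n n ℂ) : ℝ :=
  2 * ((ρ * Xᴴ).trace).re - ((σ * (X * Xᴴ)).trace).re - t * ((ρ * (Xᴴ * X)).trace).re

/-- Its maximum. -/
noncomputable def gfun {n : Type*} [Fintype n] [DecidableEq n] {ρ σ : Matrix n n ℂ}
    (hρ : ρ.IsHermitian) (hσ : σ.IsHermitian) (t : ℝ) : ℝ :=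
  ∑ i, ∑ j, Complex.normSq (ovl hρ hσ j i) *
    (hρ.eigenvalues i ^ 2 / (hσ.eigenvalues j + t * hρ.eigenvalues i))

lemma aux_vfun {n : Type*} [Fintype n] [DecidableEq n] {ρ σ : Matrix n n ℂ}
    (hρ : ρ.IsHermitian) (hσ : σ.IsHermitian) (t : ℝ) (Y : Matrix n n ℂ) :
    vfun ρ σ t ((hσ.eigenvectorUnitary : Matrix n n ℂ) * Y *
      (hρ.eigenvectorUnitary : Matrix n n ℂ)ᴴ) =
    ∑ i, ∑ j, (2 * hρ.eigenvalues i * (star (Y j i) * ovl hρ hσ j i).re -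
      (hσ.eigenvalues j + t * hρ.eigenvalues i) * Complex.normSq (Y j i)) := by
  set U := (hρ.eigenvectorUnitary : Matrix n n ℂ) with hU
  set V := (hσ.eigenvectorUnitary : Matrix n n ℂ) with hV
  set P := Matrix.diagonal (fun i => (hρ.eigenvalues i : ℂ)) with hP
  set Q := Matrix.diagonal (fun i => (hσ.eigenvalues i : ℂ)) with hQ
  have eU : Uᴴ * U = 1 := aux_UU hρ
  have eV : Vᴴ * V = 1 := aux_UU hσ
  have eρ : ρ = U * P * Uᴴ := aux_spectral hρ
  have eσ : σ = V * Q * Vᴴ := aux_spectral hσ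
  have t1 : (ρ * (V * Y * Uᴴ)ᴴ).trace = (P * Yᴴ * ovl hρ hσ).trace := by
    rw [ovl, ← hU, ← hV, eρ]
    simp only [conjTranspose_mul, conjTranspose_conjTranspose, Matrix.mul_assoc]
    rw [Matrix.trace_mul_comm]
    simp only [Matrix.mul_assoc]
    rw [← Matrix.mul_assoc Uᴴ U, eU, Matrix.one_mul]
  have t2 : (σ * ((V * Y * Uᴴ) * (V * Y * Uᴴ)ᴴ)).trace = (Q * Y * Yᴴ).trace := by
    rw [eσ]
    simp only [conjTranspose_mul, conjTranspose_conjTranspose, Matrix.mul_assoc]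
    rw [Matrix.trace_mul_comm]
    simp only [Matrix.mul_assoc]
    rw [eV, ← Matrix.mul_assoc Uᴴ U, eU, Matrix.one_mul, ← Matrix.mul_assoc Vᴴ V, eV,
      Matrix.one_mul, Matrix.mul_one]
  have t3 : (ρ * ((V * Y * Uᴴ)ᴴ * (V * Y * Uᴴ))).trace = (P * Yᴴ * Y).trace := by
    rw [eρ]
    simp only [conjTranspose_mul, conjTranspose_conjTranspose, Matrix.mul_assoc]
    rw [Matrix.trace_mul_comm]
    simp only [Matrix.mul_assoc]
    rw [eU, ← Matrix.mul_assoc Uᴴ U, eU, Matrix.one_mul, ← Matrix.mul_assoc Vᴴ V, eV,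
      Matrix.one_mul, Matrix.mul_one]
  have s1 : ((P * Yᴴ * ovl hρ hσ).trace).re =
      ∑ i, ∑ j, hρ.eigenvalues i * (star (Y j i) * ovl hρ hσ j i).re := by
    simp only [hP, Matrix.trace, Matrix.diag, Matrix.mul_apply (M := _ * _), Complex.re_sum,
      Matrix.diagonal_mul, Matrix.conjTranspose_apply]
    refine Finset.sum_congr rfl fun i _ => Finset.sum_congr rfl fun j _ => ?_
    rw [mul_assoc, Complex.re_ofReal_mul]
  have s2 : ((Q * Y * Yᴴ).trace).re =
      ∑ i, ∑ j, hσ.eigenvalues j * Complex.normSq (Y j i) := by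
    rw [Finset.sum_comm]
    simp only [hQ, Matrix.trace, Matrix.diag, Matrix.mul_apply (M := _ * _), Complex.re_sum,
      Matrix.diagonal_mul, Matrix.conjTranspose_apply]
    refine Finset.sum_congr rfl fun i _ => Finset.sum_congr rfl fun j _ => ?_
    rw [mul_assoc, Complex.re_ofReal_mul, Complex.star_def, Complex.mul_conj, Complex.ofReal_re]
  have s3 : ((P * Yᴴ * Y).trace).re =
      ∑ i, ∑ j, hρ.eigenvalues i * Complex.normSq (Y j i) := by
    simp only [hP, Matrix.trace, Matrix.diag, Matrix.mul_apply (M := _ * _), Complex.re_sum,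
      Matrix.diagonal_mul, Matrix.conjTranspose_apply]
    refine Finset.sum_congr rfl fun i _ => Finset.sum_congr rfl fun j _ => ?_
    rw [mul_assoc, Complex.re_ofReal_mul, Complex.star_def,
      ← Complex.normSq_eq_conj_mul_self, Complex.ofReal_re]
  rw [vfun, t1, t2, t3, s1, s2, s3]
  simp only [Finset.mul_sum, ← Finset.sum_sub_distrib]
  refine Finset.sum_congr rfl fun i _ => Finset.sum_congr rfl fun j _ => ?_
  ring

lemma aux_vfun_le {n : Type*} [Fintype n] [DecidableEq n] {ρ σ : Matrix n n ℂ}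
    (hρ : ρ.PosSemidef) (hσ : σ.PosDef) {t : ℝ} (ht : 0 ≤ t) (X : Matrix n n ℂ) :
    vfun ρ σ t X ≤ gfun hρ.1 hσ.1 t := by
  set U := (hρ.1.eigenvectorUnitary : Matrix n n ℂ) with hU
  set V := (hσ.1.eigenvectorUnitary : Matrix n n ℂ) with hV
  have eX : X = V * (Vᴴ * X * U) * Uᴴ := by
    have eU : U * Uᴴ = 1 := aux_UU' hρ.1
    have eV : V * Vᴴ = 1 := aux_UU' hσ.1
    rw [Matrix.mul_assoc, Matrix.mul_assoc, Matrix.mul_assoc, eU, ← Matrix.mul_assoc, eV]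
    simp
  rw [eX, aux_vfun, gfun]
  refine Finset.sum_le_sum fun i _ => Finset.sum_le_sum fun j _ => ?_
  generalize (Vᴴ * X * U) j i = y
  generalize ovl hρ.1 hσ.1 j i = w
  have hq := hσ.eigenvalues_pos j
  have hp := hρ.eigenvalues_nonneg i
  set p := hρ.1.eigenvalues i
  set q := hσ.1.eigenvalues j
  have hd : 0 < q + t * p := by positivity
  set d := q + t * p
  rw [← mul_div_assoc, le_div_iff₀ hd]
  simp only [Complex.star_def, Complex.mul_re, Complex.conj_re, Complex.conj_im,
    Complex.normSq_apply]
  nlinarith [sq_nonneg (p * w.re - d * y.re), sq_nonneg (p * w.im - d * y.im)]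

lemma aux_vfun_attained {n : Type*} [Fintype n] [DecidableEq n] {ρ σ : Matrix n n ℂ}
    (hρ : ρ.PosSemidef) (hσ : σ.PosDef) {t : ℝ} (ht : 0 ≤ t) :
    ∃ X, vfun ρ σ t X = gfun hρ.1 hσ.1 t := by
  refine ⟨_, (aux_vfun hρ.1 hσ.1 t (fun j i => ((hρ.1.eigenvalues i /
    (hσ.1.eigenvalues j + t * hρ.1.eigenvalues i) : ℝ) : ℂ) * ovl hρ.1 hσ.1 j i)).trans ?_⟩
  rw [gfun]
  refine Finset.sum_congr rfl fun i _ => Finset.sum_congr rfl fun j _ => ?_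
  generalize ovl hρ.1 hσ.1 j i = w
  have hq := hσ.eigenvalues_pos j
  have hp := hρ.eigenvalues_nonneg i
  set p := hρ.1.eigenvalues i
  set q := hσ.1.eigenvalues j
  have hd : 0 < q + t * p := by positivity
  simp only [Complex.star_def, Complex.mul_re, Complex.conj_re, Complex.conj_im,
    Complex.normSq_apply, Complex.mul_im, Complex.ofReal_re, Complex.ofReal_im]
  field_simp
  ring

/-- `σ'` represents `σ` on the image of the subsystem embedding `E`. -/
def Marg {n m : Type*} [Fintype n] [Fintype m] [DecidableEq n] [DecidableEq m]
    (E : Matrix m m ℂ →⋆ₐ[ℂ] Matrix n n ℂ) (ρ : Matrix n n ℂ) (ρ' : Matrix m m ℂ) : Prop :=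
  ∀ X, (ρ * E X).trace = (ρ' * X).trace

lemma aux_vfun_marg {n m : Type*} [Fintype n] [Fintype m] [DecidableEq n] [DecidableEq m]
    {E : Matrix m m ℂ →⋆ₐ[ℂ] Matrix n n ℂ} {ρ σ : Matrix n n ℂ} {ρ' σ' : Matrix m m ℂ}
    (h1 : Marg E ρ ρ') (h2 : Marg E σ σ') (t : ℝ) (X : Matrix m m ℂ) :
    vfun ρ σ t (E X) = vfun ρ' σ' t X := by
  have hs : (E X)ᴴ = E Xᴴ := (map_star E X).symm
  rw [vfun, vfun, hs, ← map_mul, ← map_mul, h1, h1, h2]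

lemma aux_gfun_mono {n m : Type*} [Fintype n] [Fintype m] [DecidableEq n] [DecidableEq m]
    {E : Matrix m m ℂ →⋆ₐ[ℂ] Matrix n n ℂ} {ρ σ : Matrix n n ℂ} {ρ' σ' : Matrix m m ℂ}
    (h1 : Marg E ρ ρ') (h2 : Marg E σ σ') (hρ : ρ.PosSemidef) (hσ : σ.PosDef)
    (hρ' : ρ'.PosSemidef) (hσ' : σ'.PosDef) {t : ℝ} (ht : 0 ≤ t) :
    gfun hρ'.1 hσ'.1 t ≤ gfun hρ.1 hσ.1 t := by
  obtain ⟨X, hX⟩ := aux_vfun_attained hρ' hσ' ht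
  rw [← hX, ← aux_vfun_marg h1 h2]
  exact aux_vfun_le hρ hσ ht _

/-- The primitive of `gfun`. -/
noncomputable def lfun {n : Type*} [Fintype n] [DecidableEq n] {ρ σ : Matrix n n ℂ}
    (hρ : ρ.IsHermitian) (hσ : σ.IsHermitian) (t : ℝ) : ℝ :=
  ∑ i, ∑ j, Complex.normSq (ovl hρ hσ j i) *
    (hρ.eigenvalues i * (Real.log (hσ.eigenvalues j + t * hρ.eigenvalues i) -
      Real.log (hσ.eigenvalues j)))

lemma aux_lfun_deriv {n : Type*} [Fintype n] [DecidableEq n] {ρ σ : Matrix n n ℂ}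
    (hρ : ρ.PosSemidef) (hσ : σ.PosDef) {t : ℝ} (ht : 0 ≤ t) :
    HasDerivAt (lfun hρ.1 hσ.1) (gfun hρ.1 hσ.1 t) t := by
  unfold lfun gfun
  refine HasDerivAt.fun_sum fun i _ => HasDerivAt.fun_sum fun j _ => ?_
  refine HasDerivAt.const_mul _ ?_
  have hq := hσ.eigenvalues_pos j
  have hp := hρ.eigenvalues_nonneg i
  set p := hρ.1.eigenvalues i
  set q := hσ.1.eigenvalues j
  have hd : 0 < q + t * p := by positivity
  have h := ((((hasDerivAt_id t).mul_const p).const_add q).log hd.ne').sub_const (Real.log q)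
  have h' := h.const_mul p
  refine h'.congr_deriv ?_
  simp only [id]
  field_simp

lemma aux_lfun_mono {n m : Type*} [Fintype n] [Fintype m] [DecidableEq n] [DecidableEq m]
    {E : Matrix m m ℂ →⋆ₐ[ℂ] Matrix n n ℂ} {ρ σ : Matrix n n ℂ} {ρ' σ' : Matrix m m ℂ}
    (h1 : Marg E ρ ρ') (h2 : Marg E σ σ') (hρ : ρ.PosSemidef) (hσ : σ.PosDef)
    (hρ' : ρ'.PosSemidef) (hσ' : σ'.PosDef) {t : ℝ} (ht : 0 ≤ t) :
    lfun hρ'.1 hσ'.1 t ≤ lfun hρ.1 hσ.1 t := by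
  have hd : ∀ s ∈ Set.Ici (0 : ℝ), HasDerivAt (fun s => lfun hρ.1 hσ.1 s - lfun hρ'.1 hσ'.1 s)
      (gfun hρ.1 hσ.1 s - gfun hρ'.1 hσ'.1 s) s := fun s hs =>
    (aux_lfun_deriv hρ hσ hs).sub (aux_lfun_deriv hρ' hσ' hs)
  have hm : MonotoneOn (fun s => lfun hρ.1 hσ.1 s - lfun hρ'.1 hσ'.1 s) (Set.Ici (0 : ℝ)) := by
    refine monotoneOn_of_deriv_nonneg (convex_Ici 0)
      (fun s hs => (hd s hs).continuousAt.continuousWithinAt)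
      (fun s hs => (hd s (interior_subset hs)).differentiableAt.differentiableWithinAt) ?_
    intro s hs
    rw [(hd s (interior_subset hs)).deriv]
    exact sub_nonneg.mpr (aux_gfun_mono h1 h2 hρ hσ hρ' hσ' (interior_subset hs))
  have h0 := hm (Set.self_mem_Ici) ht ht
  simp only [lfun, zero_mul, add_zero, sub_self, mul_zero, Finset.sum_const_zero] at h0
  simp only [lfun]
  linarith

lemma aux_lfun_lim {n : Type*} [Fintype n] [DecidableEq n] {ρ σ : Matrix n n ℂ}
    (hρ : ρ.PosSemidef) (hσ : σ.PosDef) :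
    Filter.Tendsto (fun t => lfun hρ.1 hσ.1 t - Real.log t * ρ.trace.re) Filter.atTop
      (nhds (relEntropy ρ σ)) := by
  rw [aux_rel hρ.1 hσ.1]
  have e : ∀ t : ℝ, lfun hρ.1 hσ.1 t - Real.log t * ρ.trace.re =
      ∑ i, ∑ j, Complex.normSq (ovl hρ.1 hσ.1 j i) * (hρ.1.eigenvalues i *
        (Real.log (hσ.1.eigenvalues j + t * hρ.1.eigenvalues i) - Real.log t -
          Real.log (hσ.1.eigenvalues j))) := by
    intro t
    have e1 : Real.log t * ρ.trace.re = ∑ i, ∑ j, Complex.normSq (ovl hρ.1 hσ.1 j i) *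
        (hρ.1.eigenvalues i * Real.log t) := by
      rw [aux_trace_eig hρ.1]
      simp only [← Finset.sum_mul, aux_ovl_sum, one_mul]
      ring
    rw [e1, lfun]
    simp only [← Finset.sum_sub_distrib]
    refine Finset.sum_congr rfl fun i _ => Finset.sum_congr rfl fun j _ => ?_
    ring
  simp only [e]
  refine tendsto_finsetSum _ fun i _ => tendsto_finsetSum _ fun j _ => ?_
  refine Filter.Tendsto.const_mul _ ?_
  have hq := hσ.eigenvalues_pos j
  have hp := hρ.eigenvalues_nonneg i
  set p := hρ.1.eigenvalues i
  set q := hσ.1.eigenvalues j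
  rcases hp.eq_or_lt with h0 | hp
  · simp [← h0]
  · refine Filter.Tendsto.const_mul _ (Filter.Tendsto.sub_const ?_ _)
    have h1 : Filter.Tendsto (fun t : ℝ => Real.log (q / t + p)) Filter.atTop
        (nhds (Real.log (0 + p))) := by
      refine Filter.Tendsto.log ?_ (by simpa using hp.ne')
      exact (Filter.Tendsto.const_div_atTop Filter.tendsto_id q).add_const p
    rw [zero_add] at h1
    refine h1.congr' ?_
    filter_upwards [Filter.eventually_gt_atTop (0 : ℝ)] with t ht
    rw [← Real.log_div (by positivity) ht.ne']
    congr 1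
    field_simp

/-- Monotonicity of relative entropy under restriction to a subsystem. -/
lemma aux_mono_s10 {n m : Type*} [Fintype n] [Fintype m] [DecidableEq n] [DecidableEq m]
    {E : Matrix m m ℂ →⋆ₐ[ℂ] Matrix n n ℂ} {ρ σ : Matrix n n ℂ} {ρ' σ' : Matrix m m ℂ}
    (h1 : Marg E ρ ρ') (h2 : Marg E σ σ') (hρ : ρ.PosSemidef) (hσ : σ.PosDef)
    (hρ' : ρ'.PosSemidef) (hσ' : σ'.PosDef) : relEntropy ρ' σ' ≤ relEntropy ρ σ := by
  have htr : ρ.trace = ρ'.trace := by simpa using h1 1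
  refine le_of_tendsto_of_tendsto (aux_lfun_lim hρ' hσ') (aux_lfun_lim hρ hσ) ?_
  filter_upwards [Filter.eventually_ge_atTop (0 : ℝ)] with t ht
  rw [htr]
  exact sub_le_sub_right (aux_lfun_mono h1 h2 hρ hσ hρ' hσ' ht) _

lemma aux_hom_herm {n m : Type*} [Fintype n] [Fintype m] [DecidableEq n] [DecidableEq m]
    (E : Matrix m m ℂ →⋆ₐ[ℂ] Matrix n n ℂ) {M : Matrix m m ℂ} (hM : M.IsHermitian) :
    (E M).IsHermitian := by
  have : star (E M) = E M := by rw [← map_star]; exact congrArg E hM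
  exact this

lemma aux_hom_matLog {n m : Type*} [Fintype n] [Fintype m] [DecidableEq n] [DecidableEq m]
    (E : Matrix m m ℂ →⋆ₐ[ℂ] Matrix n n ℂ) {M : Matrix m m ℂ} (hM : M.IsHermitian) :
    matLog (E M) = E (matLog M) := by
  rw [matLog, matLog, aux_matFun_cfc hM, aux_matFun_cfc (aux_hom_herm E hM)]
  refine (StarAlgHom.map_cfc E Real.log M ?_ ?_ hM (aux_hom_herm E hM)).symm
  · exact (Matrix.finite_real_spectrum (A := M)).continuousOn _
  · exact LinearMap.continuous_of_finiteDimensional (E.toAlgHom.toLinearMap)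

open scoped MatrixOrder Matrix.Norms.L2Operator in
lemma aux_exists_sq {m : Type*} [Fintype m] [DecidableEq m] {M : Matrix m m ℂ}
    (hM : M.PosSemidef) : ∃ B : Matrix m m ℂ, M = Bᴴ * B :=
  CStarAlgebra.nonneg_iff_eq_star_mul_self.mp hM.nonneg

lemma aux_hom_posDef {n m : Type*} [Fintype n] [Fintype m] [DecidableEq n] [DecidableEq m]
    (E : Matrix m m ℂ →⋆ₐ[ℂ] Matrix n n ℂ) {M : Matrix m m ℂ} (hM : M.PosDef) :
    (E M).PosDef := by
  have hps : (E M).PosSemidef := by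
    obtain ⟨B, rfl⟩ := aux_exists_sq hM.posSemidef
    have hs : E Bᴴ = (E B)ᴴ := map_star E B
    rw [map_mul, hs]
    exact Matrix.posSemidef_conjTranspose_mul_self _
  exact hps.posDef_iff_isUnit.mpr (hM.isUnit.map E)

lemma aux_matLog_smul {n : Type*} [Fintype n] [DecidableEq n] {M : Matrix n n ℂ} (hM : M.PosDef)
    {r : ℝ} (hr : 0 < r) : matLog ((r : ℂ) • M) = (Real.log r : ℂ) • 1 + matLog M := by
  have hh : (r • M).IsHermitian := (hM.smul hr).1
  have e : (r : ℂ) • M = r • M := by ext; simp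
  rw [e, matLog, matLog, aux_matFun_cfc hM.1, aux_matFun_cfc hh]
  have hM' : IsSelfAdjoint M := hM.1
  have hc : ∀ (f : ℝ → ℝ) (s : Set ℝ), s.Finite → ContinuousOn f s := fun f s hs =>
    hs.continuousOn f
  have hfin : (spectrum ℝ M).Finite := Matrix.finite_real_spectrum
  rw [← cfc_smul_id (R := ℝ) r M, ← cfc_comp Real.log (r • ·) M hM'
    (hc _ _ (hfin.image _)) (hc _ _ hfin)]
  have e2 : cfc (Real.log ∘ (r • ·)) M = cfc (fun z => Real.log r + Real.log z) M := by
    refine cfc_congr fun x hx => ?_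
    rw [hM.1.spectrum_real_eq_range_eigenvalues] at hx
    obtain ⟨i, rfl⟩ := hx
    exact Real.log_mul hr.ne' (hM.eigenvalues_pos i).ne'
  rw [e2, cfc_const_add _ _ _ (hc _ _ hfin) hM', Algebra.algebraMap_eq_smul_one]
  congr 1

lemma aux_rel_hom {n m : Type*} [Fintype n] [Fintype m] [DecidableEq n] [DecidableEq m]
    {E : Matrix m m ℂ →⋆ₐ[ℂ] Matrix n n ℂ} {ρ : Matrix n n ℂ} {ρ' M : Matrix m m ℂ}
    (h1 : Marg E ρ ρ') (hρ : ρ.IsHermitian) (hM : M.PosDef) :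
    relEntropy ρ (E M) = - vnEntropy ρ - ((ρ' * matLog M).trace).re := by
  rw [relEntropy, aux_hom_matLog E hM.1, Matrix.mul_sub, Matrix.trace_sub, h1, aux_vn hρ]
  simp

lemma aux_rel_smul {n : Type*} [Fintype n] [DecidableEq n] {ρ M : Matrix n n ℂ} (hM : M.PosDef)
    {r : ℝ} (hr : 0 < r) (hρ : ρ.trace = 1) :
    relEntropy ρ ((r : ℂ) • M) = relEntropy ρ M - Real.log r := by
  rw [relEntropy, relEntropy, aux_matLog_smul hM hr]
  simp only [Matrix.mul_sub, Matrix.mul_add, Matrix.trace_sub, Matrix.trace_add,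
    Matrix.mul_smul, Matrix.mul_one, Matrix.trace_smul, hρ]
  simp
  ring

lemma aux_final {n AB BC B : Type*} [Fintype n] [Fintype AB] [Fintype BC] [Fintype B]
    [DecidableEq n] [DecidableEq AB] [DecidableEq BC] [DecidableEq B]
    (E₁ : Matrix AB AB ℂ →⋆ₐ[ℂ] Matrix n n ℂ) (E₂ : Matrix BC BC ℂ →⋆ₐ[ℂ] Matrix n n ℂ)
    (F : Matrix B B ℂ →⋆ₐ[ℂ] Matrix AB AB ℂ)
    {ρ σ : Matrix n n ℂ} {ρab σab : Matrix AB AB ℂ} {ρbc : Matrix BC BC ℂ} {ρb : Matrix B B ℂ}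
    {r : ℝ} (hr : 0 < r)
    (hρ : IsDensity ρ) (hσ : IsDensity σ) (hρab : ρab.PosDef) (hσab : σab.PosSemidef)
    (hρbc : ρbc.PosDef) (hρb : ρb.PosDef)
    (m1 : Marg E₁ ρ ρab) (m3 : Marg E₁ σ σab) (m4 : Marg E₂ σ ρbc)
    (m5 : Marg F σab ρb) (m6 : Marg E₁ (E₂ ρbc) (F ρb))
    (hq : vnEntropy ρab + vnEntropy ρbc - vnEntropy ρb - vnEntropy ρ = 0) :
    relEntropy ρ ((r : ℂ) • E₁ ρab) ≤ relEntropy σ ((r : ℂ) • E₁ ρab) := by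
  rw [aux_rel_smul (aux_hom_posDef E₁ hρab) hr hρ.2, aux_rel_smul (aux_hom_posDef E₁ hρab) hr hσ.2,
    aux_rel_hom m1 hρ.1.1 hρab, aux_rel_hom m3 hσ.1.1 hρab]
  have hmono := aux_mono_s10 m3 m6 hσ.1 (aux_hom_posDef E₂ hρbc) hσab (aux_hom_posDef F hρb)
  rw [aux_rel_hom m4 hσ.1.1 hρbc, aux_rel_hom m5 hσab.1 hρb] at hmono
  have t1 : ρab.trace = 1 := by have := m1 1; simp only [map_one, Matrix.mul_one] at this; rw [← this, hρ.2]
  have t2 : σab.trace = 1 := by have := m3 1; simp only [map_one, Matrix.mul_one] at this; rw [← this, hσ.2]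
  have hk := aux_klein hσab hρab (t2.trans t1.symm)
  rw [relEntropy, Matrix.mul_sub, Matrix.trace_sub, Complex.sub_re] at hk
  have v1 := aux_vn hρab.1
  have v2 := aux_vn hσab.1
  have v3 := aux_vn hρbc.1
  have v4 := aux_vn hρb.1
  linarith

/-- `M ↦ M ⊗ id_C` on `A × B`. -/
noncomputable def homAB {A B C : Type*} [Fintype A] [Fintype B] [Fintype C]
    [DecidableEq A] [DecidableEq B] [DecidableEq C] :
    Matrix (A × B) (A × B) ℂ →⋆ₐ[ℂ] Matrix (A × B × C) (A × B × C) ℂ where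
  toFun := extAB
  map_one' := by
    ext ⟨a, b, c⟩ ⟨a', b', c'⟩
    simp only [extAB, Matrix.one_apply, Prod.mk.injEq]
    split_ifs <;> simp_all
  map_mul' M N := by
    ext ⟨a, b, c⟩ ⟨a', b', c'⟩
    simp [extAB, Matrix.mul_apply, Fintype.sum_prod_type]
  map_zero' := by ext; simp [extAB]
  map_add' M N := by ext; simp only [extAB, Matrix.add_apply, add_mul]
  commutes' r := by
    ext ⟨a, b, c⟩ ⟨a', b', c'⟩
    simp only [extAB, Matrix.algebraMap_matrix_apply, Prod.mk.injEq]
    split_ifs <;> simp_all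
  map_star' M := by
    ext ⟨a, b, c⟩ ⟨a', b', c'⟩
    simp only [extAB, Matrix.star_apply, star_mul', eq_comm (a := c)]
    split_ifs <;> simp

/-- `id_A ⊗ M`. -/
def extR {A B : Type*} [DecidableEq A] (M : Matrix B B ℂ) : Matrix (A × B) (A × B) ℂ :=
  fun x y => (if x.1 = y.1 then 1 else 0) * M x.2 y.2

/-- `M ⊗ id_C`. -/
def extL {B C : Type*} [DecidableEq C] (M : Matrix B B ℂ) : Matrix (B × C) (B × C) ℂ :=
  fun x y => M x.1 y.1 * (if x.2 = y.2 then 1 else 0)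

/-- The star homomorphism `extR`. -/
noncomputable def homR {A B : Type*} [Fintype A] [Fintype B]
    [DecidableEq A] [DecidableEq B] :
    Matrix B B ℂ →⋆ₐ[ℂ] Matrix (A × B) (A × B) ℂ where
  toFun := extR
  map_one' := by
    ext ⟨a, b⟩ ⟨a', b'⟩
    simp only [extR, Matrix.one_apply, Prod.mk.injEq]
    split_ifs <;> simp_all
  map_mul' M N := by
    ext ⟨a, b⟩ ⟨a', b'⟩
    simp [extR, Matrix.mul_apply, Fintype.sum_prod_type]
  map_zero' := by ext; simp [extR]
  map_add' M N := by ext; simp only [extR, Matrix.add_apply, mul_add]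
  commutes' r := by
    ext ⟨a, b⟩ ⟨a', b'⟩
    simp only [extR, Matrix.algebraMap_matrix_apply, Prod.mk.injEq]
    split_ifs <;> simp_all
  map_star' M := by
    ext ⟨a, b⟩ ⟨a', b'⟩
    simp only [extR, Matrix.star_apply, star_mul', eq_comm (a := a)]
    split_ifs <;> simp

/-- The star homomorphism `extL`. -/
noncomputable def homL {B C : Type*} [Fintype B] [Fintype C]
    [DecidableEq B] [DecidableEq C] :
    Matrix B B ℂ →⋆ₐ[ℂ] Matrix (B × C) (B × C) ℂ where
  toFun := extL
  map_one' := by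
    ext ⟨a, b⟩ ⟨a', b'⟩
    simp only [extL, Matrix.one_apply, Prod.mk.injEq]
    split_ifs <;> simp_all
  map_mul' M N := by
    ext ⟨a, b⟩ ⟨a', b'⟩
    simp [extL, Matrix.mul_apply, Fintype.sum_prod_type]
  map_zero' := by ext; simp [extL]
  map_add' M N := by ext; simp only [extL, Matrix.add_apply, add_mul]
  commutes' r := by
    ext ⟨a, b⟩ ⟨a', b'⟩
    simp only [extL, Matrix.algebraMap_matrix_apply, Prod.mk.injEq]
    split_ifs <;> simp_all
  map_star' M := by
    ext ⟨a, b⟩ ⟨a', b'⟩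
    simp only [extL, Matrix.star_apply, star_mul', eq_comm (a := b)]
    split_ifs <;> simp

lemma marg_AB {A B C : Type*} [Fintype A] [Fintype B] [Fintype C]
    [DecidableEq A] [DecidableEq B] [DecidableEq C] (ρ : Matrix (A × B × C) (A × B × C) ℂ) :
    Marg homAB ρ (ptC ρ) := by
  intro X
  change (ρ * extAB X).trace = _
  simp only [Matrix.trace, Matrix.diag, Matrix.mul_apply, extAB, ptC, Fintype.sum_prod_type,
    Finset.sum_mul, mul_ite, mul_one, mul_zero, Finset.sum_ite_eq', Finset.mem_univ, if_true]
  refine Finset.sum_congr rfl fun a _ => Finset.sum_congr rfl fun b _ => ?_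
  rw [Finset.sum_comm]
  refine Finset.sum_congr rfl fun a' _ => ?_
  rw [Finset.sum_comm]

lemma marg_fst {A B : Type*} [Fintype A] [Fintype B]
    [DecidableEq A] [DecidableEq B] (ρ : Matrix (A × B) (A × B) ℂ) :
    Marg homR ρ (bptFst ρ) := by
  intro X
  change (ρ * extR X).trace = _
  simp only [Matrix.trace, Matrix.diag, Matrix.mul_apply, extR, bptFst, Fintype.sum_prod_type,
    Finset.sum_mul]
  rw [Finset.sum_comm]
  refine Finset.sum_congr rfl fun b _ => ?_
  rw [Finset.sum_comm (s := (Finset.univ : Finset B))]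
  refine Finset.sum_congr rfl fun a _ => ?_
  rw [Finset.sum_eq_single a]
  · simp
  · intro c _ hc; simp [hc]
  · simp

lemma marg_snd {A B : Type*} [Fintype A] [Fintype B]
    [DecidableEq A] [DecidableEq B] (ρ : Matrix (A × B) (A × B) ℂ) :
    Marg homL ρ (bptSnd ρ) := by
  intro X
  change (ρ * extL X).trace = _
  simp only [Matrix.trace, Matrix.diag, Matrix.mul_apply, extL, bptSnd, Fintype.sum_prod_type,
    Finset.sum_mul]
  refine Finset.sum_congr rfl fun a _ => ?_
  rw [Finset.sum_comm]
  refine Finset.sum_congr rfl fun a' _ => ?_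
  refine Finset.sum_congr rfl fun b _ => ?_
  rw [Finset.sum_eq_single b]
  · simp
  · intro c _ hc; simp [hc]
  · simp

lemma ptAC_eq_snd {A B C : Type*} [Fintype A] [Fintype B] [Fintype C]
    (ρ : Matrix (A × B × C) (A × B × C) ℂ) : ptAC ρ = bptSnd (ptA ρ) := by
  ext b b'
  exact Finset.sum_comm

lemma ptAC_eq_fst {A B C : Type*} [Fintype A] [Fintype B] [Fintype C]
    (ρ : Matrix (A × B × C) (A × B × C) ℂ) : ptAC ρ = bptFst (ptC ρ) := rfl

lemma fst_sum {A B : Type*} [Fintype A] [Fintype B] (ρ : Matrix (A × B) (A × B) ℂ) :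
    bptFst ρ = ∑ a : A, ρ.submatrix (fun b => (a, b)) (fun b => (a, b)) := by
  ext b b'
  simp [bptFst, Matrix.sum_apply]

lemma ptC_sum {A B C : Type*} [Fintype A] [Fintype B] [Fintype C]
    (ρ : Matrix (A × B × C) (A × B × C) ℂ) :
    ptC ρ = ∑ c : C, ρ.submatrix (fun x : A × B => (x.1, x.2, c)) (fun x => (x.1, x.2, c)) := by
  ext b b'
  simp [ptC, Matrix.sum_apply]

lemma fst_psd {A B : Type*} [Fintype A] [Fintype B] {ρ : Matrix (A × B) (A × B) ℂ}
    (h : ρ.PosSemidef) : (bptFst ρ).PosSemidef := by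
  rw [fst_sum]
  exact Matrix.posSemidef_sum _ fun a _ => h.submatrix _

lemma fst_pd {A B : Type*} [Fintype A] [Fintype B] [Nonempty A] {ρ : Matrix (A × B) (A × B) ℂ}
    (h : ρ.PosDef) : (bptFst ρ).PosDef := by
  rw [fst_sum]
  refine Matrix.posDef_sum Finset.univ_nonempty fun a _ => h.submatrix ?_
  intro x y hxy
  simpa using hxy

lemma ptC_psd {A B C : Type*} [Fintype A] [Fintype B] [Fintype C]
    {ρ : Matrix (A × B × C) (A × B × C) ℂ} (h : ρ.PosSemidef) : (ptC ρ).PosSemidef := by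
  rw [ptC_sum]
  exact Matrix.posSemidef_sum _ fun a _ => h.submatrix _

lemma ptC_pd {A B C : Type*} [Fintype A] [Fintype B] [Fintype C] [Nonempty C]
    {ρ : Matrix (A × B × C) (A × B × C) ℂ} (h : ρ.PosDef) : (ptC ρ).PosDef := by
  rw [ptC_sum]
  refine Matrix.posDef_sum Finset.univ_nonempty fun a _ => h.submatrix ?_
  rintro ⟨x, x'⟩ ⟨y, y'⟩ hxy
  simpa using hxy

lemma ptC_homR {A B C : Type*} [Fintype A] [Fintype B] [Fintype C]
    [DecidableEq A] [DecidableEq B] [DecidableEq C] (ρ : Matrix (A × B × C) (A × B × C) ℂ) :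
    ptC (homR (ptA ρ) : Matrix (A × B × C) (A × B × C) ℂ) = homR (ptAC ρ) := by
  ext ⟨a, b⟩ ⟨a', b'⟩
  change ∑ c, (if a = a' then 1 else 0) * (∑ x, ρ (x, b, c) (x, b', c)) =
    (if a = a' then 1 else 0) * (∑ x, ∑ c, ρ (x, b, c) (x, b', c))
  rw [← Finset.mul_sum, Finset.sum_comm]

lemma ptA_homAB {A B C : Type*} [Fintype A] [Fintype B] [Fintype C]
    [DecidableEq A] [DecidableEq B] [DecidableEq C] (ρ : Matrix (A × B × C) (A × B × C) ℂ) :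
    ptA (homAB (ptC ρ) : Matrix (A × B × C) (A × B × C) ℂ) = homL (ptAC ρ) := by
  ext ⟨b, c⟩ ⟨b', c'⟩
  change ∑ a, (∑ x, ρ (a, b, x) (a, b', x)) * (if c = c' then 1 else 0)  =
    (∑ x, ∑ c, ρ (x, b, c) (x, b', c)) * (if c = c' then 1 else 0)
  rw [← Finset.sum_mul]

end Aux

/-- An invertible quantum Markov chain `ρ̃_ABC` (with `I(A:C|B)=0`) minimizes
both sequential Bayesian updating steps: it minimizes the relative entropy to the prior
`ρ_AB ⊗ id_C/d_C` among all states with marginal `ρ_BC`, and it minimizes the relative entropy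
to the prior `id_A/d_A ⊗ ρ_BC` among all states with marginal `ρ_AB`. -/
theorem qmc_minimizes_updating_steps {A B C : Type*} [Fintype A] [Fintype B] [Fintype C]
    [DecidableEq A] [DecidableEq B] [DecidableEq C]
    (ρ : Matrix (A × B × C) (A × B × C) ℂ) (hρ : IsDensity ρ) (hρinv : IsUnit ρ)
    (hqmc : qcmi ρ = 0) :
    (∀ σ : Matrix (A × B × C) (A × B × C) ℂ, IsDensity σ → ptA σ = ptA ρ →
      relEntropy ρ (((Fintype.card C : ℂ))⁻¹ • extAB (ptC ρ)) ≤
        relEntropy σ (((Fintype.card C : ℂ))⁻¹ • extAB (ptC ρ))) ∧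
    (∀ τ : Matrix (A × B × C) (A × B × C) ℂ, IsDensity τ → ptC τ = ptC ρ →
      relEntropy ρ (((Fintype.card A : ℂ))⁻¹ • extBC (ptA ρ)) ≤
        relEntropy τ (((Fintype.card A : ℂ))⁻¹ • extBC (ptA ρ))) := by
  have hne : Nonempty (A × B × C) := by
    by_contra h
    rw [not_nonempty_iff] at h
    have := hρ.2
    simp [Matrix.trace] at this
  obtain ⟨a₀, b₀, c₀⟩ := hne
  haveI : Nonempty A := ⟨a₀⟩
  haveI : Nonempty C := ⟨c₀⟩
  have hpd : ρ.PosDef := hρ.1.posDef_iff_isUnit.mpr hρinv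
  have hAB : (ptC ρ).PosDef := ptC_pd hpd
  have hBC : (ptA ρ).PosDef := fst_pd hpd
  have hB : (ptAC ρ).PosDef := fst_pd hAB
  have hcC : (0 : ℝ) < ((Fintype.card C : ℝ))⁻¹ := inv_pos.mpr (by exact_mod_cast Fintype.card_pos)
  have hcA : (0 : ℝ) < ((Fintype.card A : ℝ))⁻¹ := inv_pos.mpr (by exact_mod_cast Fintype.card_pos)
  refine ⟨fun σ hσ hm => ?_, fun τ hτ hm => ?_⟩
  · have m4 : Marg homR σ (ptA ρ) := hm ▸ marg_fst σ
    have hb : ptAC σ = ptAC ρ := by rw [ptAC_eq_snd, hm, ← ptAC_eq_snd]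
    have m5 : Marg homR (ptC σ) (ptAC ρ) := hb ▸ marg_fst (ptC σ)
    have m6 : Marg homAB (homR (ptA ρ) : Matrix (A × B × C) (A × B × C) ℂ) (homR (ptAC ρ)) :=
      ptC_homR ρ ▸ marg_AB _
    have := aux_final homAB homR homR hcC hρ hσ hAB (ptC_psd hσ.1) hBC hB (marg_AB ρ) (marg_AB σ)
      m4 m5 m6 hqmc
    rw [Complex.ofReal_inv, Complex.ofReal_natCast] at this
    exact this
  · have m4 : Marg homAB τ (ptC ρ) := hm ▸ marg_AB τ
    have hb : bptSnd (ptA τ) = ptAC ρ := by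
      rw [← ptAC_eq_snd, ptAC_eq_fst, hm, ← ptAC_eq_fst]
    have m5 : Marg homL (ptA τ) (ptAC ρ) := hb ▸ marg_snd (ptA τ)
    have m6 : Marg homR (homAB (ptC ρ) : Matrix (A × B × C) (A × B × C) ℂ) (homL (ptAC ρ)) :=
      ptA_homAB ρ ▸ marg_fst _
    have hq : vnEntropy (ptA ρ) + vnEntropy (ptC ρ) - vnEntropy (ptAC ρ) - vnEntropy ρ = 0 := by
      have := hqmc
      unfold qcmi at this
      linarith
    have := aux_final homR homAB homL hcA hρ hτ hBC (fst_psd hτ.1) hAB hB (marg_fst ρ) (marg_fst τ)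
      m4 m5 m6 hq
    rw [Complex.ofReal_inv, Complex.ofReal_natCast] at this
    exact this
end

section
/- Let ρ_AB, ρ_BC be density operators on H_A⊗H_B and H_B⊗H_C with Tr_A ρ_AB = Tr_C ρ_BC, both invertible. Let σ̃ be an invertible density operator with Tr_A σ̃ = ρ_BC such that log σ̃ − log(ρ_AB ⊗ id_C) acts only on the BC factor (i.e., equals id_A ⊗ K_BC for some Hermitian K_BC on H_B⊗H_C), and let ϱ̃ be an invertible density operator with Tr_C ϱ̃ = ρ_AB such that log ϱ̃ − log(id_A ⊗ ρ_BC) acts only on the AB factor (equals L_AB ⊗ id_C for some Hermitian L_AB on H_A⊗H_B). If σ̃ = ϱ̃, then σ̃ is compatible with both marginals (Tr_C σ̃ = ρ_AB and Tr_A σ̃ = ρ_BC) and I_{σ̃}(A:C|B) = 0, i.e., σ̃ is a quantum Markov chain in order A−B−C. -/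
open scoped Matrix ComplexOrder

variable {A B C : Type*}

namespace QMCProof

open Matrix Kronecker

set_option linter.unusedSectionVars false

section Emb
variable {n m k : Type*} [Fintype n] [Fintype m] [Fintype k] [DecidableEq n] [DecidableEq m]
  [DecidableEq k]

/-- Embedding `M ↦ M ⊗ 1`, as a star algebra homomorphism, up to an identification of indices. -/
noncomputable def emb (f : n ≃ m × k) : Matrix m m ℂ →⋆ₐ[ℂ] Matrix n n ℂ where
  toFun M := (M ⊗ₖ (1 : Matrix k k ℂ)).submatrix f f
  map_one' := by simp
  map_mul' M N := by
    rw [Matrix.submatrix_mul_equiv, ← Matrix.mul_kronecker_mul, one_mul]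
  map_zero' := by simp
  map_add' M N := by rw [Matrix.add_kronecker]; rfl
  commutes' r := by
    ext i j
    simp [Matrix.algebraMap_matrix_apply, Matrix.kroneckerMap_apply, Matrix.one_apply]
    by_cases h : i = j
    · simp [h]
    · have : f i ≠ f j := fun h' => h (f.injective h')
      rw [Ne, Prod.ext_iff] at this
      simp [h]; tauto
  map_star' M := by
    simp [Matrix.star_eq_conjTranspose, Matrix.conjTranspose_submatrix,
      Matrix.conjTranspose_kronecker]

theorem emb_apply (f : n ≃ m × k) (M : Matrix m m ℂ) (x y : n) :
    emb f M x y = M (f x).1 (f y).1 * (if (f x).2 = (f y).2 then 1 else 0) := by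
  simp [emb, Matrix.kroneckerMap_apply, Matrix.one_apply]

/-- The partial trace adjoint to `emb`. -/
noncomputable def pt (f : n ≃ m × k) (ρ : Matrix n n ℂ) : Matrix m m ℂ :=
  ∑ c : k, ρ.submatrix (fun i => f.symm (i, c)) (fun i => f.symm (i, c))

theorem pt_apply (f : n ≃ m × k) (ρ : Matrix n n ℂ) (i j : m) :
    pt f ρ i j = ∑ c, ρ (f.symm (i, c)) (f.symm (j, c)) := by
  simp [pt, Matrix.sum_apply]

theorem trace_emb (f : n ≃ m × k) (ρ : Matrix n n ℂ) (X : Matrix m m ℂ) :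
    (ρ * emb f X).trace = (pt f ρ * X).trace := by
  simp only [Matrix.trace, Matrix.diag, Matrix.mul_apply, emb_apply, pt_apply]
  rw [← f.symm.sum_comp, Fintype.sum_prod_type]
  refine Finset.sum_congr rfl fun i _ => ?_
  simp_rw [← f.symm.sum_comp (M := ℂ), Fintype.sum_prod_type, Finset.sum_mul]
  rw [Finset.sum_comm]
  refine Finset.sum_congr rfl fun j _ => ?_
  simp

theorem pt_posDef [Nonempty k] (f : n ≃ m × k) {ρ : Matrix n n ℂ} (h : ρ.PosDef) :
    (pt f ρ).PosDef := by
  refine Matrix.posDef_sum Finset.univ_nonempty fun c _ => h.submatrix ?_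
  intro i j hij
  simpa using hij

theorem emb_posDef (f : n ≃ m × k) {M : Matrix m m ℂ} (h : M.PosDef) :
    (emb f M).PosDef :=
  (h.kronecker Matrix.PosDef.one).submatrix f.injective

theorem matFun_eq_cfc (g : ℝ → ℝ) {M : Matrix n n ℂ} (h : M.IsHermitian) :
    matFun g M = cfc g M := by
  rw [h.cfc_eq, matFun, dif_pos h]
  rfl

theorem matLog_emb (f : n ≃ m × k) {M : Matrix m m ℂ} (h : M.PosDef) :
    matLog (emb f M) = emb f (matLog M) := by
  have h1 := h.1
  have h2 := (emb_posDef f h).1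
  rw [matLog, matLog, matFun_eq_cfc _ h1, matFun_eq_cfc _ h2]
  symm
  refine StarAlgHomClass.map_cfc (S := ℂ) (emb f) Real.log M ?_ ?_ h1 h2
  · rw [h1.spectrum_real_eq_range_eigenvalues]
    exact (Set.finite_range _).continuousOn _
  · exact LinearMap.continuous_of_finiteDimensional (emb f).toAlgHom.toLinearMap

end Emb

section Mono
variable {n : Type*} [Fintype n] [DecidableEq n]

theorem spectral (ρ : Matrix n n ℂ) (h : ρ.PosDef) :
    ∃ (U : Matrix n n ℂ) (p : n → ℝ), star U * U = 1 ∧ U * star U = 1 ∧ (∀ i, 0 < p i) ∧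
      ρ = U * diagonal (fun i => (p i : ℂ)) * star U ∧
      matLog ρ = U * diagonal (fun i => (Real.log (p i) : ℂ)) * star U := by
  refine ⟨h.1.eigenvectorUnitary, h.1.eigenvalues, ?_, ?_, h.eigenvalues_pos, ?_, ?_⟩
  · simp
  · simp
  · exact h.1.spectral_theorem
  · rw [matLog, matFun, dif_pos h.1]

theorem vnEntropy_eq {ρ : Matrix n n ℂ} (h : ρ.IsHermitian) :
    vnEntropy ρ = -((ρ * matLog ρ).trace).re := by
  rw [vnEntropy, dif_pos h]
  congr 1
  have h1 : ρ * matLog ρ = (h.eigenvectorUnitary : Matrix n n ℂ) *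
      (diagonal (fun i => (h.eigenvalues i : ℂ)) *
       diagonal (fun i => (Real.log (h.eigenvalues i) : ℂ))) *
        (star (h.eigenvectorUnitary : Matrix n n ℂ)) := by
    rw [matLog, matFun, dif_pos h]
    nth_rewrite 1 [h.spectral_theorem]
    rw [Unitary.conjStarAlgAut_apply]
    simp only [mul_assoc]
    rw [← mul_assoc (star (h.eigenvectorUnitary : Matrix n n ℂ)), Unitary.coe_star_mul_self,
      one_mul]
    rfl
  rw [h1, Matrix.trace_mul_comm, ← mul_assoc, Unitary.coe_star_mul_self, one_mul,
    Matrix.diagonal_mul_diagonal, Matrix.trace_diagonal, Complex.re_sum]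
  refine Finset.sum_congr rfl fun i _ => ?_
  rw [← Complex.ofReal_mul, Complex.ofReal_re]

/-- The quadratic functional. -/
noncomputable def Q (ρ σ : Matrix n n ℂ) (t : ℝ) (X : Matrix n n ℂ) : ℝ :=
  2 * ((ρ * star X).trace).re - ((σ * (X * star X)).trace).re
    - t * ((ρ * (star X * X)).trace).re

theorem trace_diag_left (p : n → ℝ) (M : Matrix n n ℂ) :
    (diagonal (fun i => (p i : ℂ)) * M).trace.re = ∑ i, p i * (M i i).re := by
  simp [Matrix.trace, Matrix.diagonal_mul]

theorem mul_star_diag (M : Matrix n n ℂ) (i : n) :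
    ((M * star M) i i).re = ∑ j, Complex.normSq (M i j) := by
  simp [Matrix.mul_apply, Matrix.star_apply, Complex.mul_conj]

theorem star_mul_diag (M : Matrix n n ℂ) (j : n) :
    ((star M * M) j j).re = ∑ i, Complex.normSq (M i j) := by
  simp [Matrix.mul_apply, Matrix.star_apply, mul_comm _ (M _ _), Complex.mul_conj]

theorem Q_eq {U V : Matrix n n ℂ} {p q : n → ℝ}
    (hU : star U * U = 1) (hV : star V * V = 1) (t : ℝ) (Y : Matrix n n ℂ) :
    Q (V * diagonal (fun i => (p i : ℂ)) * star V) (U * diagonal (fun i => (q i : ℂ)) * star U) t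
      (U * Y * star V) = ∑ i, ∑ j, (2 * p j * (star (Y i j) * (star U * V) i j).re
        - (q i + t * p j) * Complex.normSq (Y i j)) := by
  have e1 : (V * diagonal (fun i => (p i : ℂ)) * star V * star (U * Y * star V)).trace =
      (diagonal (fun i => (p i : ℂ)) * (star Y * (star U * V))).trace := by
    rw [star_mul, star_mul, star_star]
    simp only [mul_assoc]
    rw [← mul_assoc (star V) V, hV, one_mul, Matrix.trace_mul_comm]
    simp only [mul_assoc]
  have e2 : (U * diagonal (fun i => (q i : ℂ)) * star U * (U * Y * star V * star (U * Y * star V))).trace =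
      (diagonal (fun i => (q i : ℂ)) * (Y * star Y)).trace := by
    rw [star_mul, star_mul, star_star]
    simp only [mul_assoc]
    rw [← mul_assoc (star V) V, hV, one_mul, ← mul_assoc (star U) U, hU, one_mul,
      Matrix.trace_mul_comm]
    simp only [mul_assoc]
    rw [hU, mul_one]
  have e3 : (V * diagonal (fun i => (p i : ℂ)) * star V * (star (U * Y * star V) * (U * Y * star V))).trace =
      (diagonal (fun i => (p i : ℂ)) * (star Y * Y)).trace := by
    rw [star_mul, star_mul, star_star]
    simp only [mul_assoc]
    rw [← mul_assoc (star U) U, hU, one_mul, ← mul_assoc (star V) V, hV, one_mul,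
      Matrix.trace_mul_comm]
    simp only [mul_assoc]
    rw [hV, mul_one]
  rw [Q, e1, e2, e3, trace_diag_left, trace_diag_left, trace_diag_left]
  simp only [mul_star_diag, star_mul_diag]
  simp only [Matrix.mul_apply (M := star Y), Complex.re_sum,
    Finset.mul_sum, Matrix.star_apply]
  rw [Finset.sum_comm]
  nth_rewrite 3 [Finset.sum_comm]
  rw [← Finset.sum_sub_distrib, ← Finset.sum_sub_distrib]
  refine Finset.sum_congr rfl fun i _ => ?_
  rw [← Finset.sum_sub_distrib, ← Finset.sum_sub_distrib]
  refine Finset.sum_congr rfl fun j _ => ?_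
  ring

theorem scalar_le (w y : ℂ) (p s : ℝ) (hs : 0 < s) :
    2 * p * (star y * w).re - s * Complex.normSq y ≤ Complex.normSq w * (p * (p / s)) := by
  have h : Complex.normSq w * (p * (p / s)) - (2 * p * (star y * w).re - s * Complex.normSq y)
      = ((p * w.re - s * y.re)^2 + (p * w.im - s * y.im)^2) / s := by
    simp [Complex.normSq_apply]
    field_simp
    ring
  have : 0 ≤ ((p * w.re - s * y.re)^2 + (p * w.im - s * y.im)^2) / s := by positivity
  linarith

theorem scalar_eq (w : ℂ) (p s : ℝ) (hs : 0 < s) :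
    2 * p * (star (((p / s : ℝ) : ℂ) * w) * w).re - s * Complex.normSq (((p / s : ℝ) : ℂ) * w)
      = Complex.normSq w * (p * (p / s)) := by
  simp [Complex.normSq_apply]
  field_simp
  ring

theorem Q_le {U V : Matrix n n ℂ} {p q : n → ℝ}
    (hU : star U * U = 1) (hV : star V * V = 1) (hU' : U * star U = 1) (hV' : V * star V = 1)
    (hp : ∀ i, 0 < p i) (hq : ∀ i, 0 < q i) (t : ℝ) (ht : 0 ≤ t) (X : Matrix n n ℂ) :
    Q (V * diagonal (fun i => (p i : ℂ)) * star V) (U * diagonal (fun i => (q i : ℂ)) * star U) t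
      X ≤ ∑ i, ∑ j, Complex.normSq ((star U * V) i j) * (p j * (p j / (q i + t * p j))) := by
  have hX : X = U * (star U * X * V) * star V := by
    simp only [mul_assoc]
    rw [hV', mul_one, ← mul_assoc, hU', one_mul]
  rw [hX, Q_eq hU hV]
  refine Finset.sum_le_sum fun i _ => Finset.sum_le_sum fun j _ => scalar_le _ _ _ _ ?_
  have := hp j; have := hq i; positivity

theorem Q_attained {U V : Matrix n n ℂ} {p q : n → ℝ}
    (hU : star U * U = 1) (hV : star V * V = 1)
    (hp : ∀ i, 0 < p i) (hq : ∀ i, 0 < q i) (t : ℝ) (ht : 0 ≤ t) :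
    ∃ X, Q (V * diagonal (fun i => (p i : ℂ)) * star V)
      (U * diagonal (fun i => (q i : ℂ)) * star U) t X
      = ∑ i, ∑ j, Complex.normSq ((star U * V) i j) * (p j * (p j / (q i + t * p j))) := by
  refine ⟨U * (Matrix.of fun i j => ((p j / (q i + t * p j) : ℝ) : ℂ) * (star U * V) i j) *
    star V, ?_⟩
  rw [Q_eq hU hV]
  refine Finset.sum_congr rfl fun i _ => Finset.sum_congr rfl fun j _ => ?_
  rw [Matrix.of_apply]
  refine scalar_eq _ _ _ ?_
  have := hp j; have := hq i; positivity

/-- primitive in `t` of the resolvent functional -/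
noncomputable def Lf (c : n → n → ℝ) (p q : n → ℝ) (t : ℝ) : ℝ :=
  ∑ i, ∑ j, c i j * (p j * (Real.log (q i + t * p j) - Real.log (p j)))

theorem Lf_hasDerivAt (c : n → n → ℝ) {p q : n → ℝ} (hp : ∀ i, 0 < p i) (hq : ∀ i, 0 < q i)
    (t : ℝ) (ht : 0 ≤ t) :
    HasDerivAt (Lf c p q) (∑ i, ∑ j, c i j * (p j * (p j / (q i + t * p j)))) t := by
  unfold Lf
  refine HasDerivAt.fun_sum fun i _ => HasDerivAt.fun_sum fun j _ => ?_
  refine HasDerivAt.const_mul _ (HasDerivAt.const_mul _ (HasDerivAt.sub_const _ ?_))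
  refine HasDerivAt.log ?_ ?_
  · simpa using ((hasDerivAt_id t).mul_const (p j)).const_add (q i)
  · have := hp j; have := hq i; positivity

theorem Lf_tendsto (c : n → n → ℝ) {p q : n → ℝ} (hp : ∀ i, 0 < p i) (hq : ∀ i, 0 < q i) :
    Filter.Tendsto (fun t => Lf c p q t - (∑ i, ∑ j, c i j * p j) * Real.log t)
      Filter.atTop (nhds 0) := by
  have h : ∀ i j, Filter.Tendsto
      (fun t : ℝ => c i j * (p j * Real.log (q i / p j * t⁻¹ + 1)))
      Filter.atTop (nhds 0) := by
    intro i j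
    have h1 : Filter.Tendsto (fun t : ℝ => q i / p j * t⁻¹ + 1) Filter.atTop (nhds 1) := by
      simpa using (tendsto_inv_atTop_zero.const_mul (q i / p j)).add_const 1
    have h2 := ((Real.continuousAt_log one_ne_zero).tendsto.comp h1).const_mul (p j)
    simpa using h2.const_mul (c i j)
  have h2 := tendsto_finsetSum Finset.univ fun i _ =>
    tendsto_finsetSum Finset.univ fun j _ => h i j
  simp only [Finset.sum_const_zero] at h2
  refine h2.congr' ?_
  filter_upwards [Filter.eventually_gt_atTop 0] with t ht
  rw [Lf, Finset.sum_mul, ← Finset.sum_sub_distrib]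
  refine Finset.sum_congr rfl fun i _ => ?_
  rw [Finset.sum_mul, ← Finset.sum_sub_distrib]
  refine Finset.sum_congr rfl fun j _ => ?_
  have := hp j; have := hq i
  have e : q i + t * p j = p j * t * (q i / p j * t⁻¹ + 1) := by field_simp
  rw [e, Real.log_mul (by positivity) (by positivity), Real.log_mul (by positivity) (by positivity)]
  ring

theorem Lf_zero {U V : Matrix n n ℂ} {p q : n → ℝ}
    (hV : star V * V = 1) (hU' : U * star U = 1) :
    Lf (fun i j => Complex.normSq ((star U * V) i j)) p q 0 =
    -((V * diagonal (fun i => (p i : ℂ)) * star V *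
      (V * diagonal (fun i => (Real.log (p i) : ℂ)) * star V -
       U * diagonal (fun i => (Real.log (q i) : ℂ)) * star U)).trace).re := by
  have e1 : (V * diagonal (fun i => (p i : ℂ)) * star V *
      (V * diagonal (fun i => (Real.log (p i) : ℂ)) * star V)).trace
      = (diagonal (fun i => ((p i * Real.log (p i) : ℝ) : ℂ)) *
        (star (star U * V) * (star U * V))).trace := by
    rw [star_mul, star_star]
    simp only [mul_assoc]
    rw [← mul_assoc U, hU', one_mul, ← mul_assoc (star V), hV, one_mul, mul_one,
      Matrix.trace_mul_comm]
    simp only [mul_assoc]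
    rw [hV, mul_one, Matrix.diagonal_mul_diagonal]
    simp
  have e2 : (V * diagonal (fun i => (p i : ℂ)) * star V *
      (U * diagonal (fun i => (Real.log (q i) : ℂ)) * star U)).trace
      = (diagonal (fun i => (Real.log (q i) : ℂ)) *
        ((star U * V) * (diagonal (fun i => (p i : ℂ)) * star (star U * V)))).trace := by
    rw [star_mul, star_star, Matrix.trace_mul_comm]
    simp only [mul_assoc]
    rw [Matrix.trace_mul_comm]
    simp only [mul_assoc]
  rw [mul_sub, Matrix.trace_sub, e1, e2, Complex.sub_re, trace_diag_left, trace_diag_left]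
  have e3 : ∀ i, (((star U * V) * (diagonal (fun i => (p i : ℂ)) * star (star U * V))) i i).re
      = ∑ j, Complex.normSq ((star U * V) i j) * p j := by
    intro i
    rw [Matrix.mul_apply, Complex.re_sum]
    refine Finset.sum_congr rfl fun j _ => ?_
    rw [Matrix.diagonal_mul, Matrix.star_apply]
    simp [Complex.normSq_apply]
    ring
  simp only [star_mul_diag, e3, Finset.mul_sum]
  rw [Finset.sum_comm, ← Finset.sum_sub_distrib, ← Finset.sum_neg_distrib, Lf]
  refine Finset.sum_congr rfl fun i _ => ?_
  rw [← Finset.sum_sub_distrib, ← Finset.sum_neg_distrib]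
  refine Finset.sum_congr rfl fun j _ => ?_
  rw [zero_mul, add_zero]
  ring

theorem c_sum {U V : Matrix n n ℂ} {p : n → ℝ}
    (hV : star V * V = 1) (hU' : U * star U = 1) :
    ∑ i, ∑ j, Complex.normSq ((star U * V) i j) * p j =
    ((V * diagonal (fun i => (p i : ℂ)) * star V).trace).re := by
  rw [Finset.sum_comm]
  have e : star (star U * V) * (star U * V) = 1 := by
    rw [star_mul, star_star, mul_assoc, ← mul_assoc U, hU', one_mul, hV]
  have e2 : ∀ j, ∑ i, Complex.normSq ((star U * V) i j) = 1 := by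
    intro j
    rw [← star_mul_diag, e]; simp
  rw [Matrix.trace_mul_comm, ← mul_assoc, hV, one_mul, Matrix.trace_diagonal]
  simp [← Finset.sum_mul, e2]

end Mono

/-- Monotonicity of the relative entropy under partial trace. -/
theorem relEntropy_pt_le {n m k : Type*} [Fintype n] [Fintype m] [Fintype k] [DecidableEq n]
    [DecidableEq m] [DecidableEq k] [Nonempty k] (f : n ≃ m × k) {ρ σ : Matrix n n ℂ}
    (hρ : ρ.PosDef) (hσ : σ.PosDef) :
    relEntropy (pt f ρ) (pt f σ) ≤ relEntropy ρ σ := by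
  have hQ : ∀ t X, Q ρ σ t (emb f X) = Q (pt f ρ) (pt f σ) t X := by
    intro t X
    simp only [Q, ← map_star, ← map_mul, trace_emb]
  have htr : (pt f ρ).trace = ρ.trace := by
    have := trace_emb f ρ 1
    rw [map_one, mul_one, mul_one] at this
    exact this.symm
  obtain ⟨V, p, hV, hV', hp, eρ, lρ⟩ := spectral ρ hρ
  obtain ⟨U, q, hU, hU', hq, eσ, lσ⟩ := spectral σ hσ
  obtain ⟨V₁, p₁, hV₁, hV₁', hp₁, eρ₁, lρ₁⟩ := spectral _ (pt_posDef f hρ)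
  obtain ⟨U₁, q₁, hU₁, hU₁', hq₁, eσ₁, lσ₁⟩ := spectral _ (pt_posDef f hσ)
  have z := Lf_zero (p := p) (q := q) hV hU'
  have z₁ := Lf_zero (p := p₁) (q := q₁) hV₁ hU₁'
  rw [← lρ, ← lσ, ← eρ] at z
  rw [← lρ₁, ← lσ₁, ← eρ₁] at z₁
  have s := c_sum (p := p) hV hU'
  have s₁ := c_sum (p := p₁) hV₁ hU₁'
  rw [← eρ] at s
  rw [← eρ₁, htr, ← s] at s₁
  set c := fun i j => Complex.normSq ((star U * V) i j) with hc
  set c₁ := fun i j => Complex.normSq ((star U₁ * V₁) i j) with hc₁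
  have hder : ∀ t : ℝ, 0 ≤ t →
      ∑ i, ∑ j, c₁ i j * (p₁ j * (p₁ j / (q₁ i + t * p₁ j))) ≤
      ∑ i, ∑ j, c i j * (p j * (p j / (q i + t * p j))) := by
    intro t ht
    obtain ⟨X, hX⟩ := Q_attained hU₁ hV₁ hp₁ hq₁ t ht
    have h2 := Q_le hU hV hU' hV' hp hq t ht (emb f X)
    rw [← eρ, ← eσ, hQ] at h2
    rw [← eρ₁, ← eσ₁] at hX
    rw [← hX]
    exact h2
  have hd : ∀ t : ℝ, 0 ≤ t → HasDerivAt (fun t => Lf c p q t - Lf c₁ p₁ q₁ t) _ t :=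
    fun t ht => (Lf_hasDerivAt c hp hq t ht).sub (Lf_hasDerivAt c₁ hp₁ hq₁ t ht)
  have hmono : MonotoneOn (fun t => Lf c p q t - Lf c₁ p₁ q₁ t) (Set.Ici 0) := by
    refine monotoneOn_of_deriv_nonneg (convex_Ici 0)
      (fun t ht => (hd t ht).continuousAt.continuousWithinAt)
      (fun t ht => (hd t (interior_subset ht)).differentiableAt.differentiableWithinAt) ?_
    intro t ht
    have ht' : 0 ≤ t := interior_subset ht
    rw [(hd t ht').deriv]
    exact sub_nonneg.2 (hder t ht')
  have hlim : Filter.Tendsto (fun t => Lf c p q t - Lf c₁ p₁ q₁ t) Filter.atTop (nhds 0) := by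
    have := (Lf_tendsto c hp hq).sub (Lf_tendsto c₁ hp₁ hq₁)
    rw [sub_zero, s₁] at this
    refine this.congr fun t => ?_
    ring
  have hfin : Lf c p q 0 - Lf c₁ p₁ q₁ 0 ≤ 0 := by
    refine ge_of_tendsto hlim ?_
    filter_upwards [Filter.eventually_ge_atTop 0] with t ht
    exact hmono (Set.mem_Ici.2 le_rfl) (Set.mem_Ici.2 ht) ht
  rw [z, z₁] at hfin
  unfold relEntropy
  linarith

theorem trace_emb_self {n m k : Type*} [Fintype n] [Fintype m] [Fintype k] [DecidableEq n]
    [DecidableEq m] [DecidableEq k] (f : n ≃ m × k) (M : Matrix m m ℂ) :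
    (emb f M).trace = (Fintype.card k : ℂ) * M.trace := by
  simp only [Matrix.trace, Matrix.diag, emb_apply]
  rw [← f.symm.sum_comp, Fintype.sum_prod_type]
  simp [Finset.mul_sum]

section Tri
variable {A B C : Type*} [Fintype A] [Fintype B] [Fintype C]
    [DecidableEq A] [DecidableEq B] [DecidableEq C]

theorem extAB_eq (M : Matrix (A × B) (A × B) ℂ) :
    (extAB M : Matrix (A × B × C) (A × B × C) ℂ) = emb (Equiv.prodAssoc A B C).symm M := by
  ext x y
  rw [emb_apply]; rfl

theorem extBC_eq (M : Matrix (B × C) (B × C) ℂ) :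
    (extBC M : Matrix (A × B × C) (A × B × C) ℂ) = emb (Equiv.prodComm A (B × C)) M := by
  ext x y
  rw [emb_apply, mul_comm]; rfl

theorem ptC_eq (ρ : Matrix (A × B × C) (A × B × C) ℂ) :
    ptC ρ = pt (Equiv.prodAssoc A B C).symm ρ := by
  ext x y
  rw [pt_apply]; rfl

theorem ptA_eq (ρ : Matrix (A × B × C) (A × B × C) ℂ) :
    ptA ρ = pt (Equiv.prodComm A (B × C)) ρ := by
  ext x y
  rw [pt_apply]; rfl

theorem ptAC_eq_fst (ρ : Matrix (A × B × C) (A × B × C) ℂ) :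
    ptAC ρ = pt (Equiv.prodComm A B) (ptC ρ) := by
  ext x y
  rw [pt_apply]; rfl

theorem ptAC_eq_snd (ρ : Matrix (A × B × C) (A × B × C) ℂ) :
    ptAC ρ = pt (Equiv.refl (B × C)) (ptA ρ) := by
  ext x y
  rw [pt_apply, ptAC, Finset.sum_comm]; rfl

theorem pt_emb_one (R : Matrix (A × B) (A × B) ℂ) :
    pt (Equiv.prodComm A (B × C)) (emb (Equiv.prodAssoc A B C).symm R) =
      emb (Equiv.refl (B × C)) (pt (Equiv.prodComm A B) R) := by
  ext x y
  simp only [pt_apply, emb_apply, Finset.sum_mul]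
  rfl

theorem pt_emb_two (T : Matrix (B × C) (B × C) ℂ) :
    pt (Equiv.prodAssoc A B C).symm (emb (Equiv.prodComm A (B × C)) T) =
      emb (Equiv.prodComm A B) (pt (Equiv.refl (B × C)) T) := by
  ext x y
  simp only [pt_apply, emb_apply, Finset.sum_mul]
  rfl

theorem emb_emb (X : Matrix B B ℂ) :
    emb (Equiv.prodAssoc A B C).symm (emb (Equiv.prodComm A B) X) =
      emb (Equiv.prodComm A (B × C)) (emb (Equiv.refl (B × C)) X) := by
  ext x y
  simp only [emb_apply]
  simp only [mul_assoc]
  congr 1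
  exact mul_comm _ _

theorem main (ρAB : Matrix (A × B) (A × B) ℂ) (ρBC : Matrix (B × C) (B × C) ℂ)
    (σ : Matrix (A × B × C) (A × B × C) ℂ) (hσ : σ.PosDef) (htr : σ.trace = 1)
    (hR : ρAB.PosDef) (hT : ρBC.PosDef)
    (h1 : ptC σ = ρAB) (h2 : ptA σ = ρBC) (K : Matrix (B × C) (B × C) ℂ)
    (hlog : matLog σ - matLog (extAB ρAB) = extBC K) : qcmi σ = 0 := by
  have hne : Nonempty (A × B × C) := by
    by_contra h
    rw [not_nonempty_iff] at h
    simp [Matrix.trace] at htr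
  obtain ⟨a₀, b₀, c₀⟩ := hne
  haveI : Nonempty A := ⟨a₀⟩
  haveI : Nonempty C := ⟨c₀⟩
  have hB1 : ptAC σ = pt (Equiv.prodComm A B) ρAB := by rw [ptAC_eq_fst, h1]
  have hB2 : ptAC σ = pt (Equiv.refl (B × C)) ρBC := by rw [ptAC_eq_snd, h2]
  have hB : (ptAC σ).PosDef := by rw [hB1]; exact pt_posDef _ hR
  rw [qcmi, h1, h2, vnEntropy_eq hR.1, vnEntropy_eq hT.1, vnEntropy_eq hB.1, vnEntropy_eq hσ.1]
  set P := ptAC σ with hP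
  have h1' := h1
  have h2' := h2
  rw [ptC_eq] at h1'
  rw [ptA_eq] at h2'
  rw [extAB_eq, extBC_eq, matLog_emb _ hR] at hlog
  have tR : (σ * emb (Equiv.prodAssoc A B C).symm (matLog ρAB)).trace
      = (ρAB * matLog ρAB).trace := by rw [trace_emb, h1']
  have tP : (ρBC * emb (Equiv.refl (B × C)) (matLog P)).trace = (P * matLog P).trace := by
    rw [trace_emb, ← hB2]
  have tK : (ρBC * K).trace = (σ * matLog σ).trace - (ρAB * matLog ρAB).trace := by
    rw [← tR, ← Matrix.trace_sub, ← mul_sub, hlog, trace_emb, h2']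
  have i1 := relEntropy_pt_le (Equiv.prodComm A (B × C)) hσ
    (emb_posDef (Equiv.prodAssoc A B C).symm hR)
  rw [pt_emb_one, ← hB1, h2', relEntropy, relEntropy, matLog_emb _ hB, matLog_emb _ hR, mul_sub,
    mul_sub, Matrix.trace_sub, Matrix.trace_sub, tR, tP, Complex.sub_re, Complex.sub_re] at i1
  have i2 := relEntropy_pt_le (Equiv.prodAssoc A B C).symm
    (emb_posDef (Equiv.prodComm A (B × C)) hT) hσ
  have hl : matLog σ = emb (Equiv.prodComm A (B × C)) K +
      emb (Equiv.prodAssoc A B C).symm (matLog ρAB) := by rw [← hlog]; abel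
  rw [relEntropy, relEntropy, mul_sub, Matrix.trace_sub, ← trace_emb, ← trace_emb, pt_emb_two,
    ← hB2, h1', matLog_emb _ hB, emb_emb, matLog_emb _ hT, hl, mul_sub, mul_add, ← map_mul,
    ← map_mul, ← map_mul, Matrix.trace_sub, Matrix.trace_add, trace_emb_self, trace_emb_self,
    trace_emb_self, tP, tK] at i2
  have hd : (0 : ℝ) < Fintype.card A := by exact_mod_cast Fintype.card_pos
  simp only [Complex.sub_re, Complex.add_re, Complex.mul_re, Complex.natCast_re,
    Complex.natCast_im, zero_mul, sub_zero] at i2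
  have i3 : (Fintype.card A : ℝ) * (P * matLog P).trace.re ≤ (Fintype.card A : ℝ) *
      ((ρBC * matLog ρBC).trace.re -
        ((σ * matLog σ).trace.re - (ρAB * matLog ρAB).trace.re)) := by
    linarith
  have i4 := le_of_mul_le_mul_left i3 hd
  linarith

end Tri

theorem posDef_of {n : Type*} [Fintype n] [DecidableEq n] {ρ : Matrix n n ℂ} (h : IsDensity ρ)
    (hu : IsUnit ρ) : ρ.PosDef :=
  h.1.posDef_iff_isUnit.2 hu

end QMCProof

/-- If the two single-step Bayesian updating posteriors coincide, the common
state is a quantum Markov chain: given `σ̃` with `Tr_A σ̃ = ρ_BC` whose log differs from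
`log (ρ_AB ⊗ id_C)` by an operator on the `BC` factor, and `ϱ̃` with `Tr_C ϱ̃ = ρ_AB` whose log
differs from `log (id_A ⊗ ρ_BC)` by an operator on the `AB` factor, if `σ̃ = ϱ̃` then `σ̃` is
compatible with both marginals and `I_{σ̃}(A:C|B) = 0`. -/
theorem equal_updating_posteriors_give_qmc {A B C : Type*} [Fintype A] [Fintype B] [Fintype C]
    [DecidableEq A] [DecidableEq B] [DecidableEq C]
    (ρAB : Matrix (A × B) (A × B) ℂ) (ρBC : Matrix (B × C) (B × C) ℂ)
    (hAB : IsDensity ρAB) (hBC : IsDensity ρBC)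
    (hB : bptFst ρAB = bptSnd ρBC)
    (hABinv : IsUnit ρAB) (hBCinv : IsUnit ρBC)
    (σ ϱ : Matrix (A × B × C) (A × B × C) ℂ)
    (hσd : IsDensity σ) (hσinv : IsUnit σ) (hσm : ptA σ = ρBC)
    (K : Matrix (B × C) (B × C) ℂ) (hK : K.IsHermitian)
    (hσlog : matLog σ - matLog (extAB ρAB) = extBC K)
    (hϱd : IsDensity ϱ) (hϱinv : IsUnit ϱ) (hϱm : ptC ϱ = ρAB)
    (L : Matrix (A × B) (A × B) ℂ) (hL : L.IsHermitian)
    (hϱlog : matLog ϱ - matLog (extBC ρBC) = extAB L)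
    (heq : σ = ϱ) :
    ptC σ = ρAB ∧ ptA σ = ρBC ∧ qcmi σ = 0 := by
  subst heq
  exact ⟨hϱm, hσm, QMCProof.main ρAB ρBC σ (QMCProof.posDef_of hσd hσinv) hσd.2
    (QMCProof.posDef_of hAB hABinv) (QMCProof.posDef_of hBC hBCinv) hϱm hσm K hσlog⟩
end
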